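/- arXiv:2512.20231 — 6 statements merged into one kernel-verified Lean document; each statement's English description precedes it below -/
import Mathlib

section
/- Let μ be a positive Borel measure on [0,∞) and let ω(t) = ∫_{[0,∞)} e^{−λt} dμ(λ) be finite for every t > 0. Let u : [0,∞) → ℝ be continuous and bounded, and fix t > 0. Define A(t) = ∫_0^t ω(t−s) u(s) ds and B(t) = ∫_0^t ω(t−s) u(s)² ds, and assume A and B are differentiable at t. Then u(t)·A′(t) ≥ (1/2)·B′(t). -/
open MeasureTheory Set

/-- The renewal probabilities of a sequence `a`, determined by
`a (m + 1) = ∑ j ≤ m, renewal a j * a (m - j)`. -/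
noncomputable def renewal (a : ℕ → ℝ) (m : ℕ) : ℝ :=
  (a (m + 1) - ∑ j : Fin m, renewal a j * a (m - j)) / a 0

/-- The tails of the renewal probabilities of `a`. -/
noncomputable def renewalTail (a : ℕ → ℝ) (m : ℕ) : ℝ :=
  1 - ∑ j ∈ Finset.range m, renewal a j

/-- The discrete convolution of `α` with the renewal tails of `a`. -/
noncomputable def renewalConv (a α : ℕ → ℝ) (m : ℕ) : ℝ :=
  ∑ j ∈ Finset.range (m + 1), renewalTail a j * α (m - j)

lemma renewal_equation {a : ℕ → ℝ} (ha : a 0 ≠ 0) (m : ℕ) :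
    ∑ j ∈ Finset.range (m + 1), renewal a j * a (m - j) = a (m + 1) := by
  rw [Finset.sum_range_succ, Nat.sub_self]
  conv_lhs => rw [renewal.eq_1 a m]
  rw [div_mul_cancel₀ _ ha, Fin.sum_univ_eq_sum_range (fun j => renewal a j * a (m - j))]
  ring

/-- Kaluza's theorem. -/
lemma renewal_nonneg {a : ℕ → ℝ} (ha : ∀ m, 0 < a m)
    (hlc : ∀ k m, k ≤ m → a (k + 1) * a m ≤ a (m + 1) * a k) (m : ℕ) : 0 ≤ renewal a m := by
  induction m using Nat.strong_induction_on with
  | _ m ih =>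
    rcases m with _ | m
    · rw [renewal.eq_1]
      simpa using (div_pos (ha 1) (ha 0)).le
    have h1 := renewal_equation (ha 0).ne' (m + 1)
    have h0 := renewal_equation (ha 0).ne' m
    rw [Finset.sum_range_succ, Nat.sub_self] at h1
    have key : (∑ j ∈ Finset.range (m + 1), renewal a j * a (m + 1 - j)) * a (m + 1)
        ≤ a (m + 2) * ∑ j ∈ Finset.range (m + 1), renewal a j * a (m - j) := by
      rw [Finset.sum_mul, Finset.mul_sum]
      refine Finset.sum_le_sum fun j hj => ?_
      have hj' : j ≤ m := Nat.lt_succ_iff.mp (Finset.mem_range.mp hj)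
      have := mul_le_mul_of_nonneg_left (hlc (m - j) (m + 1) (by omega)) (ih j (by omega))
      rw [show m + 1 - j = m - j + 1 by omega]
      linarith
    rw [h0] at key
    have := le_of_mul_le_mul_right key (ha (m + 1))
    exact nonneg_of_mul_nonneg_left (by linarith) (ha 0)

lemma renewalTail_succ (a : ℕ → ℝ) (m : ℕ) :
    renewalTail a (m + 1) = renewalTail a m - renewal a m := by
  simp only [renewalTail, Finset.sum_range_succ]
  ring

lemma renewalTail_zero (a : ℕ → ℝ) : renewalTail a 0 = 1 := by simp [renewalTail]

lemma renewalConv_zero (a α : ℕ → ℝ) : renewalConv a α 0 = α 0 := by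
  simp [renewalConv, renewalTail_zero]

lemma renewalConv_succ (a α : ℕ → ℝ) (m : ℕ) :
    renewalConv a α (m + 1) = renewalConv a α m +
      (α (m + 1) - ∑ j ∈ Finset.range (m + 1), renewal a j * α (m - j)) := by
  rw [renewalConv, Finset.sum_range_succ']
  simp only [Nat.add_sub_add_right, renewalTail_succ, sub_mul, Finset.sum_sub_distrib,
    renewalTail_zero, renewalConv, Nat.sub_zero]
  ring

lemma renewalConv_self {a : ℕ → ℝ} (ha : a 0 ≠ 0) (m : ℕ) : renewalConv a a m = a 0 := by
  induction m with
  | zero => exact renewalConv_zero a a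
  | succ m ih => rw [renewalConv_succ, renewal_equation ha, ih]; ring

lemma renewalTail_nonneg {a : ℕ → ℝ} (ha : ∀ m, 0 < a m) (hanti : Antitone a)
    (hp : ∀ m, 0 ≤ renewal a m) (m : ℕ) : 0 ≤ renewalTail a m := by
  rcases m with _ | m
  · simp [renewalTail]
  have h := renewal_equation (ha 0).ne' m
  have h2 : ∑ j ∈ Finset.range (m + 1), renewal a j * a (m + 1)
      ≤ ∑ j ∈ Finset.range (m + 1), renewal a j * a (m - j) :=
    Finset.sum_le_sum fun j _ => mul_le_mul_of_nonneg_left (hanti (by omega)) (hp j)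
  rw [h, ← Finset.sum_mul] at h2
  have : ∑ j ∈ Finset.range (m + 1), renewal a j ≤ 1 :=
    le_of_mul_le_mul_right (by linarith) (ha (m + 1))
  rw [renewalTail]
  linarith

lemma renewalTail_antitone {a : ℕ → ℝ} (hp : ∀ m, 0 ≤ renewal a m) :
    Antitone (renewalTail a) :=
  antitone_nat_of_succ_le fun m => by rw [renewalTail_succ]; linarith [hp m]

lemma renewalTail_mul_le {a : ℕ → ℝ} (ha : ∀ m, 0 < a m) (hanti : Antitone a)
    (hp : ∀ m, 0 ≤ renewal a m) (m : ℕ) : renewalTail a m * ((m + 1) * a m) ≤ a 0 := by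
  rw [← renewalConv_self (ha 0).ne' m, renewalConv]
  calc renewalTail a m * ((m + 1) * a m)
      = ∑ j ∈ Finset.range (m + 1), renewalTail a m * a m := by simp; ring
    _ ≤ _ := Finset.sum_le_sum fun j hj => by
      have hj' : j ≤ m := Nat.lt_succ_iff.mp (Finset.mem_range.mp hj)
      exact mul_le_mul (renewalTail_antitone hp hj') (hanti (by omega)) (ha m).le
        (renewalTail_nonneg ha hanti hp j)

lemma sum_renewalConv (a α : ℕ → ℝ) (n : ℕ) :
    ∑ m ∈ Finset.range (n + 1), renewalConv a α m =
      ∑ j ∈ Finset.range (n + 1), renewalTail a j * ∑ i ∈ Finset.range (n - j + 1), α i := by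
  induction n with
  | zero => simp [renewalConv]
  | succ n ih =>
    rw [Finset.sum_range_succ, ih, Finset.sum_range_succ _ (n + 1), renewalConv,
      Finset.sum_range_succ _ (n + 1), ← add_assoc, ← Finset.sum_add_distrib]
    congr 1
    · refine Finset.sum_congr rfl fun j hj => ?_
      have hj' : j ≤ n := Nat.lt_succ_iff.mp (Finset.mem_range.mp hj)
      rw [show n + 1 - j = n - j + 1 by omega, Finset.sum_range_succ _ (n - j + 1)]
      ring
    · simp

lemma le_sum_renewalTail_mul_sum {a : ℕ → ℝ} (ha : ∀ m, 0 < a m) (hanti : Antitone a)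
    (hp : ∀ m, 0 ≤ renewal a m) (n : ℕ) :
    (n + 1) * a 0 ≤
      (∑ j ∈ Finset.range (n + 1), renewalTail a j) * ∑ i ∈ Finset.range (n + 1), a i := by
  have h := sum_renewalConv a a n
  simp only [renewalConv_self (ha 0).ne', Finset.sum_const, Finset.card_range, nsmul_eq_mul] at h
  push_cast at h
  rw [h, Finset.sum_mul]
  refine Finset.sum_le_sum fun j _ => mul_le_mul_of_nonneg_left ?_
    (renewalTail_nonneg ha hanti hp j)
  exact Finset.sum_le_sum_of_subset_of_nonneg (Finset.range_subset_range.2 (by omega))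
    fun i _ _ => (ha i).le

lemma sum_renewal_mul_add (a : ℕ → ℝ) (n : ℕ) :
    ∑ j ∈ Finset.range n, renewal a j * (j + 1) + renewalTail a n * (n + 1) =
      ∑ j ∈ Finset.range (n + 1), renewalTail a j := by
  induction n with
  | zero => simp
  | succ n ih =>
    rw [Finset.sum_range_succ, Finset.sum_range_succ _ (n + 1), ← ih, renewalTail_succ]
    push_cast
    ring

/-- The increments of `renewalConv a α`, i.e. the values of `α` convolved with `δ₀ - renewal a`. -/
noncomputable def renewalDefect (a α : ℕ → ℝ) : ℕ → ℝ
  | 0 => α 0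
  | m + 1 => α (m + 1) - ∑ j ∈ Finset.range (m + 1), renewal a j * α (m - j)

lemma sum_renewalDefect (a α : ℕ → ℝ) (n : ℕ) :
    ∑ m ∈ Finset.range (n + 1), renewalDefect a α m = renewalConv a α n := by
  induction n with
  | zero => simp [renewalDefect, renewalConv_zero]
  | succ n ih => rw [Finset.sum_range_succ, ih, renewalConv_succ, renewalDefect]

lemma renewalDefect_succ_nonpos {a α : ℕ → ℝ} (ha : ∀ m, 0 < a m) (hp : ∀ m, 0 ≤ renewal a m)
    (h : ∀ k m, k ≤ m → α m * a k ≤ α k * a m) (m : ℕ) : renewalDefect a α (m + 1) ≤ 0 := by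
  have h1 : ∑ j ∈ Finset.range (m + 1), renewal a j * a (m - j) * α (m + 1)
      ≤ ∑ j ∈ Finset.range (m + 1), renewal a j * α (m - j) * a (m + 1) :=
    Finset.sum_le_sum fun j _ => by
      have := mul_le_mul_of_nonneg_left (h (m - j) (m + 1) (by omega)) (hp j)
      linarith
  rw [← Finset.sum_mul, ← Finset.sum_mul, renewal_equation (ha 0).ne', mul_comm] at h1
  have := le_of_mul_le_mul_right h1 (ha (m + 1))
  rw [renewalDefect]
  linarith

lemma renewalDefect_succ_nonneg {a α : ℕ → ℝ} (ha : ∀ m, 0 < a m) (hp : ∀ m, 0 ≤ renewal a m)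
    (h : ∀ k m, k ≤ m → α k * a m ≤ α m * a k) (m : ℕ) : 0 ≤ renewalDefect a α (m + 1) := by
  have h1 : ∑ j ∈ Finset.range (m + 1), renewal a j * α (m - j) * a (m + 1)
      ≤ ∑ j ∈ Finset.range (m + 1), renewal a j * a (m - j) * α (m + 1) :=
    Finset.sum_le_sum fun j _ => by
      have := mul_le_mul_of_nonneg_left (h (m - j) (m + 1) (by omega)) (hp j)
      linarith
  rw [← Finset.sum_mul, ← Finset.sum_mul, renewal_equation (ha 0).ne',
    mul_comm (a (m + 1))] at h1
  have := le_of_mul_le_mul_right h1 (ha (m + 1))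
  rw [renewalDefect]
  linarith

lemma sum_mul_renewalDefect_le_of_antitone_ratio {a α f : ℕ → ℝ} (ha : ∀ m, 0 < a m)
    (hp : ∀ m, 0 ≤ renewal a m) (h : ∀ k m, k ≤ m → α m * a k ≤ α k * a m)
    (hf : ∀ m, 0 ≤ f m) (n : ℕ) :
    ∑ m ∈ Finset.range (n + 1), f m * renewalDefect a α m ≤ f 0 * α 0 := by
  rw [Finset.sum_range_succ']
  have : ∑ m ∈ Finset.range n, f (m + 1) * renewalDefect a α (m + 1) ≤ 0 :=
    Finset.sum_nonpos fun m _ =>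
      mul_nonpos_of_nonneg_of_nonpos (hf _) (renewalDefect_succ_nonpos ha hp h m)
  simpa [renewalDefect] using this

lemma sum_mul_renewalDefect_le_of_monotone_ratio {a α f : ℕ → ℝ} (ha : ∀ m, 0 < a m)
    (hanti : Antitone a) (hp : ∀ m, 0 ≤ renewal a m) (h : ∀ k m, k ≤ m → α k * a m ≤ α m * a k)
    (hle : ∀ m, α m ≤ a m) (hge : ∀ m, a (m + 1) ≤ α m) {M n : ℕ} (hMn : M ≤ n) {δ' δ : ℝ}
    (hδ : 0 ≤ δ) (hδ' : 0 ≤ δ') (hf' : ∀ m ≤ M, f m ≤ δ') (hf : ∀ m ≤ n, f m ≤ δ) :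
    ∑ m ∈ Finset.range (n + 1), f m * renewalDefect a α m ≤
      δ' * a 0 + δ * (a 0 * renewalTail a (M + 1)) := by
  have hβ := renewalTail_nonneg ha hanti hp
  have hG : ∀ m, 0 ≤ renewalDefect a α m := by
    rintro (_ | m)
    · exact (ha 1).le.trans (hge 0)
    · exact renewalDefect_succ_nonneg ha hp h m
  have hup : ∀ m, renewalConv a α m ≤ a 0 := fun m => by
    rw [← renewalConv_self (ha 0).ne' m]
    exact Finset.sum_le_sum fun j _ => mul_le_mul_of_nonneg_left (hle _) (hβ j)
  have hlow : a 0 - a 0 * renewalTail a (M + 1) ≤ renewalConv a α M := by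
    have h1 := renewalConv_self (ha 0).ne' (M + 1)
    rw [renewalConv, Finset.sum_range_succ, Nat.sub_self] at h1
    have : ∑ j ∈ Finset.range (M + 1), renewalTail a j * a (M + 1 - j) ≤ renewalConv a α M :=
      Finset.sum_le_sum fun j hj => by
        have hj' : j ≤ M := Nat.lt_succ_iff.mp (Finset.mem_range.mp hj)
        rw [show M + 1 - j = M - j + 1 by omega]
        exact mul_le_mul_of_nonneg_left (hge _) (hβ j)
    linarith
  have hn := sum_renewalDefect a α n
  have hM := sum_renewalDefect a α M
  rw [← Finset.sum_range_add_sum_Ico _ (Nat.succ_le_succ hMn)] at hn ⊢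
  have h1 : ∑ m ∈ Finset.range (M + 1), f m * renewalDefect a α m ≤ δ' * renewalConv a α M := by
    rw [← hM, Finset.mul_sum]
    exact Finset.sum_le_sum fun m hm => mul_le_mul_of_nonneg_right
      (hf' m (Nat.lt_succ_iff.mp (Finset.mem_range.mp hm))) (hG m)
  have h2 : ∑ m ∈ Finset.Ico (M + 1) (n + 1), f m * renewalDefect a α m ≤
      δ * ∑ m ∈ Finset.Ico (M + 1) (n + 1), renewalDefect a α m := by
    rw [Finset.mul_sum]
    exact Finset.sum_le_sum fun m hm => mul_le_mul_of_nonneg_right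
      (hf m (Nat.lt_succ_iff.mp (Finset.mem_Ico.mp hm).2)) (hG m)
  have h3 := mul_le_mul_of_nonneg_left (hup M) hδ'
  have h4 : ∑ m ∈ Finset.Ico (M + 1) (n + 1), renewalDefect a α m ≤
      a 0 * renewalTail a (M + 1) := by
    have := hup n
    simp only [Nat.succ_eq_add_one] at hn
    linarith
  exact add_le_add (h1.trans h3) (h2.trans (mul_le_mul_of_nonneg_left h4 hδ))

/-- A positive, decreasing, continuous and log-convex function on `(0, ∞)`. -/
structure LogConvexKernel (ω : ℝ → ℝ) : Prop where
  pos : ∀ x, 0 < x → 0 < ω x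
  anti : AntitoneOn ω (Ioi 0)
  cont : ContinuousOn ω (Ioi 0)
  logConvex : ∀ x y d, 0 < x → x ≤ y → 0 ≤ d → ω (x + d) * ω y ≤ ω x * ω (y + d)

section

variable {ω f : ℝ → ℝ} {t : ℝ}

lemma integrableOn_indicator_Iic (ht : 0 ≤ t) (hint : IntervalIntegrable ω volume 0 t) :
    IntegrableOn ((Ioi 0).indicator ω) (Iic t) := by
  rw [IntegrableOn, integrable_indicator_iff measurableSet_Ioi, IntegrableOn,
    Measure.restrict_restrict measurableSet_Ioi, Ioi_inter_Iic]
  exact (intervalIntegrable_iff_integrableOn_Ioc_of_le ht).1 hint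

lemma intervalIntegrable_indicator_sub_mul (ht : 0 ≤ t) (hint : IntervalIntegrable ω volume 0 t)
    (hf : ContinuousOn f (Icc 0 t)) {x : ℝ} (hx : 0 ≤ x) :
    IntervalIntegrable (fun y => (Ioi 0).indicator ω (y - x) * f y) volume 0 t := by
  refine IntervalIntegrable.mul_continuousOn ?_ (by rwa [uIcc_of_le ht])
  have h : IntervalIntegrable ((Ioi 0).indicator ω) volume (0 - x) (t - x) := by
    rw [intervalIntegrable_iff_integrableOn_Ioc_of_le (by linarith)]
    exact (integrableOn_indicator_Iic ht hint).mono_set fun y hy =>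
      mem_Iic.2 (hy.2.trans (by linarith))
  simpa using h.comp_sub_right x

lemma LogConvexKernel.antitone_ratio (hω : LogConvexKernel ω) {η s σ : ℝ} (hη : 0 < η)
    (hs : 0 < s) (hsσ : s ≤ σ) {k m : ℕ} (hkm : k ≤ m) :
    ω (k * η + σ) * ω (m * η + s) ≤ ω (m * η + σ) * ω (k * η + s) := by
  have hkm' : (k : ℝ) * η ≤ m * η := by gcongr
  have hk : 0 ≤ (k : ℝ) * η := by positivity
  have := hω.logConvex (k * η + s) (m * η + s) (σ - s) (by linarith) (by linarith) (by linarith)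
  rw [show (k : ℝ) * η + s + (σ - s) = k * η + σ by ring,
    show (m : ℝ) * η + s + (σ - s) = m * η + σ by ring] at this
  linarith

lemma LogConvexKernel.renewal_nonneg (hω : LogConvexKernel ω) {η s : ℝ} (hη : 0 < η)
    (hs : 0 < s) (m : ℕ) : 0 ≤ renewal (fun m => ω (m * η + s)) m := by
  refine _root_.renewal_nonneg (fun m => hω.pos _ (by positivity)) (fun k m hkm => ?_) m
  have := hω.antitone_ratio hη hs (σ := s + η) (by linarith) hkm
  push_cast
  rw [show ((k : ℝ) + 1) * η + s = k * η + (s + η) by ring,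
    show ((m : ℝ) + 1) * η + s = m * η + (s + η) by ring]
  exact this

lemma LogConvexKernel.antitone_sample (hω : LogConvexKernel ω) {η s : ℝ} (hη : 0 < η)
    (hs : 0 < s) : Antitone fun m : ℕ => ω (m * η + s) := fun k m hkm =>
  hω.anti (mem_Ioi.2 (by positivity)) (mem_Ioi.2 (by positivity)) (by gcongr)

/-- The kernel `ω`, extended by zero, convolved with the measure
`δ₀ - ∑ j < N, p j • δ_{(j+1)η} - (tail N) • δ_{(N+1)η}`, with `p` the renewal sequence of `a`. -/
noncomputable def testKernel (ω : ℝ → ℝ) (a : ℕ → ℝ) (η : ℝ) (N : ℕ) (y : ℝ) : ℝ :=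
  (Ioi 0).indicator ω y
    - ∑ j ∈ Finset.range N, renewal a j * (Ioi 0).indicator ω (y - (j + 1) * η)
    - renewalTail a N * (Ioi 0).indicator ω (y - (N + 1) * η)

lemma testKernel_eq_renewalDefect (a : ℕ → ℝ) {η σ : ℝ} (hσ : 0 < σ) (hση : σ < η) {N m : ℕ}
    (hm : m ≤ N) :
    testKernel ω a η N (m * η + σ) = renewalDefect a (fun m => ω (m * η + σ)) m := by
  have hη : 0 < η := hσ.trans hση
  have hz : ∀ j : ℕ, m ≤ j → (Ioi 0).indicator ω (m * η + σ - (j + 1) * η) = 0 := fun j hj => by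
    have : (m : ℝ) * η ≤ j * η := by gcongr
    exact indicator_of_notMem (by rw [mem_Ioi]; linarith) _
  have hnz : ∀ j : ℕ, (Ioi 0).indicator ω (j * η + σ) = ω (j * η + σ) := fun j =>
    indicator_of_mem (mem_Ioi.2 (by positivity)) _
  rw [testKernel, hz N hm, hnz, mul_zero, sub_zero]
  rcases m with _ | m
  · rw [Finset.sum_eq_zero fun j _ => by rw [hz j (Nat.zero_le j), mul_zero], sub_zero,
      renewalDefect]
  · rw [renewalDefect]
    congr 1
    rw [← Finset.sum_range_add_sum_Ico _ hm, Finset.sum_eq_zero (s := Finset.Ico _ _)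
      fun j hj => by rw [hz j (Finset.mem_Ico.1 hj).1, mul_zero], add_zero]
    refine Finset.sum_congr rfl fun j hj => ?_
    have hj' : j ≤ m := Nat.lt_succ_iff.mp (Finset.mem_range.mp hj)
    rw [← hnz, Nat.cast_sub hj']
    congr 2
    push_cast
    ring

lemma sum_renewal_add_renewalTail (a : ℕ → ℝ) (N : ℕ) :
    ∑ j ∈ Finset.range N, renewal a j + renewalTail a N = 1 := by
  rw [renewalTail]
  ring

lemma LogConvexKernel.testKernel_nonpos (hω : LogConvexKernel ω) {a : ℕ → ℝ}
    (hp : ∀ m, 0 ≤ renewal a m) (hβ : ∀ m, 0 ≤ renewalTail a m) {η : ℝ} (hη : 0 < η) {N : ℕ}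
    {y : ℝ} (hy : (N + 1) * η < y) : testKernel ω a η N y ≤ 0 := by
  have hy0 : 0 < y := lt_trans (by positivity) hy
  have hge : ∀ j : ℕ, j ≤ N → ω y ≤ (Ioi 0).indicator ω (y - (j + 1) * η) := fun j hj => by
    have h1 : ((j : ℝ) + 1) * η ≤ (N + 1) * η := by gcongr
    have h2 : (0 : ℝ) < (j + 1) * η := by positivity
    have h3 : y - (j + 1) * η ∈ Ioi (0 : ℝ) := mem_Ioi.2 (by linarith)
    rw [indicator_of_mem h3]
    exact hω.anti h3 hy0 (by linarith)
  have h1 : ∑ j ∈ Finset.range N, renewal a j * ω y ≤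
      ∑ j ∈ Finset.range N, renewal a j * (Ioi 0).indicator ω (y - (j + 1) * η) :=
    Finset.sum_le_sum fun j hj =>
      mul_le_mul_of_nonneg_left (hge j (Finset.mem_range.1 hj).le) (hp j)
  have h2 := mul_le_mul_of_nonneg_left (hge N le_rfl) (hβ N)
  rw [← Finset.sum_mul] at h1
  have h3 : ω y = (∑ j ∈ Finset.range N, renewal a j) * ω y + renewalTail a N * ω y := by
    rw [← add_mul, sum_renewal_add_renewalTail, one_mul]
  rw [testKernel, indicator_of_mem (mem_Ioi.2 hy0)]
  linarith

lemma intervalIntegrable_testKernel_mul (ht : 0 ≤ t) (hint : IntervalIntegrable ω volume 0 t)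
    (hf : ContinuousOn f (Icc 0 t)) (a : ℕ → ℝ) {η : ℝ} (hη : 0 ≤ η) (N : ℕ) :
    IntervalIntegrable (fun y => testKernel ω a η N y * f y) volume 0 t ∧
    ∫ y in 0..t, testKernel ω a η N y * f y =
      (∫ y in 0..t, (Ioi 0).indicator ω (y - 0) * f y)
      - ∑ j ∈ Finset.range N,
          renewal a j * (∫ y in 0..t, (Ioi 0).indicator ω (y - (j + 1) * η) * f y)
      - renewalTail a N * ∫ y in 0..t, (Ioi 0).indicator ω (y - (N + 1) * η) * f y := by
  have h0 := intervalIntegrable_indicator_sub_mul ht hint hf le_rfl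
  have hj : ∀ j : ℕ, IntervalIntegrable
      (fun y => (Ioi 0).indicator ω (y - (j + 1) * η) * f y) volume 0 t := fun j =>
    intervalIntegrable_indicator_sub_mul ht hint hf (by positivity)
  have hs : ∀ j ∈ Finset.range N, IntervalIntegrable
      (fun y => renewal a j * ((Ioi 0).indicator ω (y - (j + 1) * η) * f y)) volume 0 t :=
    fun j _ => (hj j).const_mul _
  have hs' : IntervalIntegrable (fun y => ∑ j ∈ Finset.range N,
      renewal a j * ((Ioi 0).indicator ω (y - (j + 1) * η) * f y)) volume 0 t := by
    simpa only [Finset.sum_fn] using IntervalIntegrable.sum _ hs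
  have heq : (fun y => testKernel ω a η N y * f y) = fun y =>
      (Ioi 0).indicator ω (y - 0) * f y
      - ∑ j ∈ Finset.range N, renewal a j * ((Ioi 0).indicator ω (y - (j + 1) * η) * f y)
      - renewalTail a N * ((Ioi 0).indicator ω (y - (N + 1) * η) * f y) := by
    ext y
    rw [testKernel, sub_mul, sub_mul, Finset.sum_mul, sub_zero]
    simp only [mul_assoc]
  rw [heq]
  refine ⟨(h0.sub hs').sub ((hj N).const_mul _), ?_⟩
  rw [intervalIntegral.integral_sub (h0.sub hs') ((hj N).const_mul _),
    intervalIntegral.integral_sub h0 hs', intervalIntegral.integral_finsetSum hs]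
  simp only [intervalIntegral.integral_const_mul]

lemma LogConvexKernel.integral_testKernel_mul_le (hω : LogConvexKernel ω) (ht : 0 ≤ t)
    (hint : IntervalIntegrable ω volume 0 t) (hf : ContinuousOn f (Icc 0 t))
    (hf0 : ∀ y ∈ Icc 0 t, 0 ≤ f y) {η s : ℝ} {M N : ℕ} (hMN : M ≤ N)
    (hNt : (N + 1) * η ≤ t) (hs : 0 < s) (hsη : s < η)
    {δ δ' : ℝ} (hδ : 0 ≤ δ) (hδ' : 0 ≤ δ') (hfδ : ∀ y ∈ Icc 0 t, f y ≤ δ)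
    (hfδ' : ∀ y ∈ Icc 0 ((M + 1) * η), f y ≤ δ') :
    ∫ y in 0..t, testKernel ω (fun m => ω (m * η + s)) η N y * f y ≤
      δ' * ((∫ x in 0..η, ω x) + η * ω s) +
        δ * (η * ω s) * renewalTail (fun m => ω (m * η + s)) (M + 1) := by
  set a : ℕ → ℝ := fun m => ω (m * η + s) with ha_def
  have hη : 0 < η := hs.trans hsη
  have ha : ∀ m, 0 < a m := fun m => hω.pos _ (by positivity)
  have hanti : Antitone a := hω.antitone_sample hη hs
  have hp : ∀ m, 0 ≤ renewal a m := hω.renewal_nonneg hη hs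
  have hβ := renewalTail_nonneg ha hanti hp
  have ha0 : a 0 = ω s := by simp [ha_def]
  have hNη : 0 < ((N : ℝ) + 1) * η := by positivity
  obtain ⟨hK, -⟩ := intervalIntegrable_testKernel_mul ht hint hf a hη.le N
  have hsub : ∀ x y, 0 ≤ x → x ≤ y → y ≤ t →
      IntervalIntegrable (fun y => testKernel ω a η N y * f y) volume x y := fun x y h1 h2 h3 =>
    hK.mono_set (by
      rw [uIcc_of_le h2, uIcc_of_le ht]
      exact Icc_subset_Icc h1 h3)
  have htail : ∫ y in ((N + 1) * η)..t, testKernel ω a η N y * f y ≤ 0 := by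
    rw [← neg_nonneg, ← intervalIntegral.integral_neg]
    have := intervalIntegral.integral_mono_on_of_le_Ioo (f := fun _ => (0 : ℝ)) hNt
      intervalIntegrable_const (hsub _ _ hNη.le hNt le_rfl).neg fun y hy => by
        simp only [Pi.neg_apply, Left.nonneg_neg_iff]
        exact mul_nonpos_of_nonpos_of_nonneg (hω.testKernel_nonpos hp hβ hη hy.1)
          (hf0 y ⟨hNη.le.trans hy.1.le, hy.2.le⟩)
    simpa using this
  have hcell : ∀ m < N + 1, IntervalIntegrable (fun y => testKernel ω a η N y * f y) volume
      ((m : ℝ) * η) ((m + 1 : ℕ) * η) := fun m hm => by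
    refine hsub _ _ (by positivity) (by gcongr; simp) (le_trans ?_ hNt)
    have : ((m + 1 : ℕ) : ℝ) ≤ N + 1 := by exact_mod_cast hm
    gcongr
  have hcell' : ∀ m ∈ Finset.range (N + 1), IntervalIntegrable
      (fun σ => testKernel ω a η N (m * η + σ) * f (m * η + σ)) volume 0 η := fun m hm => by
    have := (hcell m (Finset.mem_range.1 hm)).comp_add_left (m * η)
    convert this using 1
    · ring
    · push_cast
      ring
  have hsplit : ∫ y in 0..((N + 1) * η), testKernel ω a η N y * f y =
      ∫ σ in 0..η, ∑ m ∈ Finset.range (N + 1),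
        testKernel ω a η N (m * η + σ) * f (m * η + σ) := by
    have := intervalIntegral.sum_integral_adjacent_intervals (a := fun m : ℕ => (m : ℝ) * η) hcell
    simp only [Nat.cast_zero, zero_mul, Nat.cast_add, Nat.cast_one] at this
    rw [← this, intervalIntegral.integral_finsetSum hcell']
    refine Finset.sum_congr rfl fun m _ => ?_
    rw [intervalIntegral.integral_comp_add_left
      (fun y => testKernel ω a η N y * f y) ((m : ℝ) * η)]
    congr 1 <;> ring
  have hηt : η ≤ t := by
    have : 0 ≤ (N : ℝ) * η := by positivity
    linarith
  have hωη : IntervalIntegrable ω volume 0 η := hint.mono_set (by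
      rw [uIcc_of_le hη.le, uIcc_of_le ht]
      exact Icc_subset_Icc le_rfl hηt)
  have hpt : ∀ σ ∈ Ioo 0 η, ∑ m ∈ Finset.range (N + 1),
      testKernel ω a η N (m * η + σ) * f (m * η + σ) ≤
        δ' * (ω σ + a 0) + δ * (a 0 * renewalTail a (M + 1)) := by
    rintro σ ⟨hσ, hση⟩
    have hmem : ∀ m : ℕ, ∀ k : ℕ, m ≤ k → (m : ℝ) * η + σ ∈ Icc 0 ((k + 1) * η) := by
      intro m k hmk
      have : (m : ℝ) * η ≤ k * η := by gcongr
      exact ⟨by positivity, by linarith⟩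
    have hmem' : ∀ m : ℕ, m ≤ N → (m : ℝ) * η + σ ∈ Icc 0 t := fun m hm =>
      ⟨(hmem m N hm).1, (hmem m N hm).2.trans hNt⟩
    set φ : ℕ → ℝ := fun m => if m ≤ N then f (m * η + σ) else 0 with hφ
    have hrew : ∑ m ∈ Finset.range (N + 1), testKernel ω a η N (m * η + σ) * f (m * η + σ) =
        ∑ m ∈ Finset.range (N + 1), φ m * renewalDefect a (fun m => ω (m * η + σ)) m := by
      refine Finset.sum_congr rfl fun m hm => ?_
      have hm' : m ≤ N := Nat.lt_succ_iff.mp (Finset.mem_range.mp hm)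
      rw [testKernel_eq_renewalDefect a hσ hση hm', mul_comm, hφ]
      simp only [hm', if_true]
    have hωσ : 0 < ω σ := hω.pos σ hσ
    have h0 : 0 ≤ δ * (a 0 * renewalTail a (M + 1)) :=
      mul_nonneg hδ (mul_nonneg (ha 0).le (hβ _))
    have hφδ' : ∀ m ≤ M, φ m ≤ δ' := fun m hm => by
      simp only [hφ, hm.trans hMN, if_true]
      exact hfδ' _ (hmem m M hm)
    rw [hrew]
    rcases le_total σ s with hle | hle
    · refine (sum_mul_renewalDefect_le_of_antitone_ratio ha hp (fun k m hkm => ?_)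
        (fun m => ?_) N).trans ?_
      · have := hω.antitone_ratio hη hσ hle hkm
        simp only [ha_def]
        linarith
      · simp only [hφ]
        split_ifs with hm
        · exact hf0 _ (hmem' m hm)
        · exact le_rfl
      · have h1 := mul_le_mul_of_nonneg_right (hφδ' 0 (Nat.zero_le M)) hωσ.le
        have h2 := mul_nonneg hδ' (ha 0).le
        simp only [Nat.cast_zero, zero_mul, zero_add]
        linarith
    · refine (sum_mul_renewalDefect_le_of_monotone_ratio ha hanti hp (fun k m hkm => ?_)
        (fun m => ?_) (fun m => ?_) hMN hδ hδ' hφδ' (fun m hm => ?_)).trans ?_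
      · exact hω.antitone_ratio hη hs hle hkm
      · exact hω.anti (mem_Ioi.2 (by positivity)) (mem_Ioi.2 (by positivity)) (by gcongr)
      · refine hω.anti (mem_Ioi.2 (by positivity)) (mem_Ioi.2 (by positivity)) ?_
        push_cast
        linarith
      · simp only [hφ, hm, if_true]
        exact hfδ _ (hmem' m hm)
      · have h1 := mul_nonneg hδ' hωσ.le
        linarith
  have hmono := intervalIntegral.integral_mono_on_of_le_Ioo hη.le (by
      simpa only [Finset.sum_fn] using IntervalIntegrable.sum _ hcell') (((hωη.add intervalIntegrable_const).const_mul δ').add intervalIntegrable_const) hpt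
  rw [← intervalIntegral.integral_add_adjacent_intervals (hsub 0 _ le_rfl hNη.le hNt)
    (hsub _ t hNη.le hNt le_rfl), hsplit]
  rw [intervalIntegral.integral_add
    ((hωη.add intervalIntegrable_const).const_mul δ') intervalIntegrable_const,
    intervalIntegral.integral_const_mul, intervalIntegral.integral_add hωη
    intervalIntegrable_const, intervalIntegral.integral_const,
    intervalIntegral.integral_const, smul_eq_mul, smul_eq_mul, sub_zero, ha0] at hmono
  linarith

end

section

variable {ω f : ℝ → ℝ} {t : ℝ}

lemma IntervalIntegrable.mono_zero (ht : 0 ≤ t) (hint : IntervalIntegrable ω volume 0 t) {x y : ℝ}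
    (hx : 0 ≤ x) (hxy : x ≤ y) (hy : y ≤ t) : IntervalIntegrable ω volume x y :=
  hint.mono_set (by
    rw [uIcc_of_le hxy, uIcc_of_le ht]
    exact Icc_subset_Icc hx hy)

lemma hasDerivAt_integral_of_continuousOn_Ioi (hcont : ContinuousOn ω (Ioi 0)) {x : ℝ}
    (hx : 0 < x) (hint : IntervalIntegrable ω volume 0 x) :
    HasDerivAt (fun r => ∫ y in 0..r, ω y) (ω x) x :=
  intervalIntegral.integral_hasDerivAt_right hint
    (hcont.stronglyMeasurableAtFilter isOpen_Ioi x hx) (hcont.continuousAt (Ioi_mem_nhds hx))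

lemma continuousOn_integral_Icc (ht : 0 ≤ t) (hint : IntervalIntegrable ω volume 0 t) :
    ContinuousOn (fun r => ∫ y in 0..r, ω y) (Icc 0 t) := by
  have := intervalIntegral.continuousOn_primitive_interval (μ := volume) (f := ω) (a := 0) (b := t)
    (by
      rw [uIcc_of_le ht, integrableOn_Icc_iff_integrableOn_Ioc]
      exact (intervalIntegrable_iff_integrableOn_Ioc_of_le ht).1 hint)
  rwa [uIcc_of_le ht] at this

lemma exists_mul_eq_integral (hcont : ContinuousOn ω (Ioi 0)) {η : ℝ} (hη : 0 < η)
    (hint : IntervalIntegrable ω volume 0 η) :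
    ∃ s ∈ Ioo 0 η, η * ω s = ∫ y in 0..η, ω y := by
  obtain ⟨s, hs, h⟩ := exists_hasDerivAt_eq_slope (fun r => ∫ y in 0..r, ω y) ω hη
    (continuousOn_integral_Icc hη.le hint) fun x hx =>
      hasDerivAt_integral_of_continuousOn_Ioi hcont hx.1
        (hint.mono_zero hη.le le_rfl hx.1.le hx.2.le)
  refine ⟨s, hs, ?_⟩
  rw [h]
  simp only [intervalIntegral.integral_same, sub_zero]
  field_simp

lemma LogConvexKernel.mul_sum_sample_le (hω : LogConvexKernel ω) (ht : 0 ≤ t)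
    (hint : IntervalIntegrable ω volume 0 t) {η s : ℝ} (hη : 0 < η) (hs : 0 < s)
    (hsη : η * ω s = ∫ y in 0..η, ω y) (n : ℕ) (hn : n * η ≤ t) :
    η * ∑ i ∈ Finset.range (n + 1), ω (i * η + s) ≤
      (∫ y in 0..η, ω y) + ∫ y in 0..(n * η), ω y := by
  induction n with
  | zero => simp [hsη]
  | succ n ih =>
    have hn' : (n : ℝ) * η ≤ (n + 1 : ℕ) * η := by gcongr; simp
    have h0 : 0 ≤ (n : ℝ) * η := by positivity
    have hI := hint.mono_zero ht h0 hn' hn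
    rw [Finset.sum_range_succ, mul_add]
    have := ih (hn'.trans hn)
    have h1 : η * ω ((n + 1 : ℕ) * η + s) ≤ ∫ y in (n * η)..((n + 1 : ℕ) * η), ω y := by
      have h2 := intervalIntegral.integral_mono_on_of_le_Ioo hn'
        (intervalIntegrable_const (c := ω ((n + 1 : ℕ) * η + s))) hI fun x hx =>
          hω.anti (mem_Ioi.2 (h0.trans_lt hx.1)) (mem_Ioi.2 (by positivity))
            (by linarith [hx.2])
      rw [intervalIntegral.integral_const, smul_eq_mul] at h2
      convert h2 using 2
      push_cast
      ring
    rw [← intervalIntegral.integral_add_adjacent_intervals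
      (hint.mono_zero ht le_rfl h0 (hn'.trans hn)) hI]
    linarith

lemma LogConvexKernel.integral_pos (hω : LogConvexKernel ω) (ht : 0 < t)
    (hint : IntervalIntegrable ω volume 0 t) : 0 < ∫ y in 0..t, ω y :=
  intervalIntegral.intervalIntegral_pos_of_pos_on hint (fun x hx => hω.pos x hx.1) ht

lemma LogConvexKernel.mul_le_of_linear_growth (hω : LogConvexKernel ω) (ht : 0 ≤ t)
    (hint : IntervalIntegrable ω volume 0 t) (hf : ContinuousOn f (Icc 0 t))
    (hf0 : ∀ y ∈ Icc 0 t, 0 ≤ f y) {c h η : ℝ} (hη : 0 < η) (hc : 0 ≤ c) {M N : ℕ} (hMN : M < N)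
    (hh : h = (N + 1) * η) (hht : h ≤ t)
    (hP : ∀ x ∈ Ioc 0 h, c * x ≤ (∫ y in 0..t, (Ioi 0).indicator ω (y - 0) * f y) -
      ∫ y in 0..t, (Ioi 0).indicator ω (y - x) * f y)
    {δ δ' : ℝ} (hδ : 0 ≤ δ) (hδ' : 0 ≤ δ') (hfδ : ∀ y ∈ Icc 0 t, f y ≤ δ)
    (hfδ' : ∀ y ∈ Icc 0 ((M + 1) * η), f y ≤ δ') :
    c * h ≤ 2 * (∫ y in 0..h, ω y) * (2 * δ' +
      δ * ((∫ y in 0..η, ω y) / ((M + 1) * η * ω ((M + 2) * η)))) := by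
  have hN0 : (0 : ℝ) ≤ N := Nat.cast_nonneg N
  have hηh : η ≤ h := by rw [hh]; nlinarith
  obtain ⟨s, ⟨hs, hsη⟩, hsW⟩ := exists_mul_eq_integral hω.cont hη
    (hint.mono_zero ht le_rfl hη.le (hηh.trans hht))
  set a : ℕ → ℝ := fun m => ω (m * η + s) with ha_def
  have ha : ∀ m, 0 < a m := fun m => hω.pos _ (by positivity)
  have hanti : Antitone a := hω.antitone_sample hη hs
  have hp : ∀ m, 0 ≤ renewal a m := hω.renewal_nonneg hη hs
  have hβ := renewalTail_nonneg ha hanti hp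
  have ha0 : a 0 = ω s := by simp [ha_def]
  have hWη := hω.integral_pos hη (hint.mono_zero ht le_rfl hη.le (hηh.trans hht))
  have hbound := hω.integral_testKernel_mul_le ht hint hf hf0 hMN.le (hh ▸ hht) hs hsη hδ hδ'
    hfδ hfδ'
  rw [hsW, (intervalIntegrable_testKernel_mul ht hint hf a hη.le N).2] at hbound
  set P : ℝ → ℝ := fun x => ∫ y in 0..t, (Ioi 0).indicator ω (y - x) * f y with hPdef
  have hPj : ∀ j : ℕ, j ≤ N → c * ((j + 1) * η) ≤ P 0 - P ((j + 1) * η) := fun j hj =>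
    hP _ ⟨by positivity, by rw [hh]; gcongr⟩
  have hlow : c * (η * ∑ j ∈ Finset.range (N + 1), renewalTail a j) ≤
      P 0 - ∑ j ∈ Finset.range N, renewal a j * P ((j + 1) * η)
        - renewalTail a N * P ((N + 1) * η) := by
    have h1 : ∑ j ∈ Finset.range N, renewal a j * (c * ((j + 1) * η)) ≤
        ∑ j ∈ Finset.range N, renewal a j * (P 0 - P ((j + 1) * η)) :=
      Finset.sum_le_sum fun j hj =>
        mul_le_mul_of_nonneg_left (hPj j (Finset.mem_range.1 hj).le) (hp j)
    have h2 := mul_le_mul_of_nonneg_left (hPj N le_rfl) (hβ N)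
    have h3 : P 0 = (∑ j ∈ Finset.range N, renewal a j) * P 0 + renewalTail a N * P 0 := by
      rw [← add_mul, sum_renewal_add_renewalTail, one_mul]
    have h4 : ∑ j ∈ Finset.range N, renewal a j * (c * ((j + 1) * η)) =
        c * η * ∑ j ∈ Finset.range N, renewal a j * (j + 1) := by
      rw [Finset.mul_sum]
      exact Finset.sum_congr rfl fun j _ => by ring
    simp only [mul_sub, Finset.sum_sub_distrib] at h1
    rw [← Finset.sum_mul, h4] at h1
    rw [← sum_renewal_mul_add]
    linarith
  have hmass : h * (∫ y in 0..η, ω y) ≤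
      (η * ∑ j ∈ Finset.range (N + 1), renewalTail a j) * (2 * ∫ y in 0..h, ω y) := by
    have h1 := le_sum_renewalTail_mul_sum ha hanti hp N
    have hNh : (N : ℝ) * η ≤ h := by rw [hh]; linarith
    have h2 := hω.mul_sum_sample_le ht hint hη hs hsW N (hNh.trans hht)
    have hmono : ∀ r, 0 ≤ r → r ≤ h → ∫ y in 0..r, ω y ≤ ∫ y in 0..h, ω y := fun r hr hrh => by
      rw [← intervalIntegral.integral_add_adjacent_intervals
        (hint.mono_zero ht le_rfl hr (hrh.trans hht)) (hint.mono_zero ht hr hrh hht)]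
      have := intervalIntegral.integral_mono_on_of_le_Ioo (f := fun _ => (0 : ℝ)) hrh
        intervalIntegrable_const (hint.mono_zero ht hr hrh hht)
        fun x hx => (hω.pos x (hr.trans_lt hx.1)).le
      simp only [intervalIntegral.integral_zero] at this
      linarith
    have h3 := hmono η hη.le hηh
    have h4 := hmono (N * η) (by positivity) hNh
    have hS : 0 ≤ ∑ j ∈ Finset.range (N + 1), renewalTail a j := Finset.sum_nonneg fun j _ => hβ j
    calc h * (∫ y in 0..η, ω y) = η * η * ((N + 1) * a 0) := by rw [← hsW, hh, ha0]; ring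
      _ ≤ η * η * ((∑ j ∈ Finset.range (N + 1), renewalTail a j) *
          ∑ i ∈ Finset.range (N + 1), a i) := by gcongr
      _ = (η * ∑ j ∈ Finset.range (N + 1), renewalTail a j) *
          (η * ∑ i ∈ Finset.range (N + 1), a i) := by ring
      _ ≤ _ := mul_le_mul_of_nonneg_left (by linarith) (mul_nonneg hη.le hS)
  have htail : renewalTail a (M + 1) ≤
      (∫ y in 0..η, ω y) / ((M + 1) * η * ω ((M + 2) * η)) := by
    have hω2 : 0 < ω ((M + 2) * η) := hω.pos _ (by positivity)
    rw [le_div_iff₀ (by positivity), ← hsW, ← ha0]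
    have h1 := renewalTail_mul_le ha hanti hp (M + 1)
    have h2 : ω ((M + 2) * η) ≤ a (M + 1) := by
      refine hω.anti (mem_Ioi.2 (by positivity)) (mem_Ioi.2 (by positivity)) ?_
      push_cast
      linarith
    have h3 : ((M : ℝ) + 1) * ω ((M + 2) * η) ≤ ((M + 1 : ℕ) + 1) * a (M + 1) := by
      push_cast
      gcongr
      linarith
    calc renewalTail a (M + 1) * ((M + 1) * η * ω ((M + 2) * η))
        = η * (renewalTail a (M + 1) * ((M + 1) * ω ((M + 2) * η))) := by ring
      _ ≤ η * (renewalTail a (M + 1) * (((M + 1 : ℕ) + 1) * a (M + 1))) := by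
        gcongr
        exact hβ _
      _ ≤ η * a 0 := by gcongr
  have hWh := hω.integral_pos (hη.trans_le hηh) (hint.mono_zero ht le_rfl (hη.le.trans hηh) hht)
  set W := ∫ y in 0..η, ω y
  set Q := W / ((M + 1) * η * ω ((M + 2) * η))
  have hup : c * (η * ∑ j ∈ Finset.range (N + 1), renewalTail a j) ≤ W * (2 * δ' + δ * Q) := by
    have h1 : δ * W * renewalTail a (M + 1) ≤ δ * W * Q :=
      mul_le_mul_of_nonneg_left htail (mul_nonneg hδ hWη.le)
    simp only [sub_zero, hPdef] at hlow hbound ⊢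
    linarith
  have h1 := mul_le_mul_of_nonneg_left hmass hc
  have h2 := mul_le_mul_of_nonneg_right hup (by linarith : (0 : ℝ) ≤ 2 * ∫ y in 0..h, ω y)
  refine le_of_mul_le_mul_right ?_ hWη
  linarith

lemma LogConvexKernel.not_linear_growth (hω : LogConvexKernel ω) (ht : 0 ≤ t)
    (hint : IntervalIntegrable ω volume 0 t) (hf : ContinuousOn f (Icc 0 t))
    (hf0 : ∀ y ∈ Icc 0 t, 0 ≤ f y) (hfz : f 0 = 0) {c h : ℝ} (hc : 0 < c) (hh : 0 < h)
    (hht : h ≤ t) :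
    ¬ ∀ x ∈ Ioc 0 h, c * x ≤ (∫ y in 0..t, (Ioi 0).indicator ω (y - 0) * f y) -
      ∫ y in 0..t, (Ioi 0).indicator ω (y - x) * f y := by
  intro hP
  have hWh := hω.integral_pos hh (hint.mono_zero ht le_rfl hh.le hht)
  set Wh := ∫ y in 0..h, ω y
  set ε := c * h / (8 * Wh) with hε_def
  have hε : 0 < ε := by positivity
  obtain ⟨δ, hδ⟩ := isCompact_Icc.bddAbove_image hf
  have hfδ : ∀ y ∈ Icc 0 t, f y ≤ δ := fun y hy => hδ (mem_image_of_mem f hy)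
  have hδ0 : 0 ≤ δ := (hf0 0 ⟨le_rfl, ht⟩).trans (hfδ 0 ⟨le_rfl, ht⟩)
  obtain ⟨d, hd, hfd⟩ := Metric.continuousOn_iff.1 hf 0 ⟨le_rfl, ht⟩ ε hε
  obtain ⟨L, hL⟩ := exists_nat_gt (h / d)
  have hL0 : (0 : ℝ) < L := lt_trans (by positivity) hL
  have hLd : h / (L + 1) < d := by
    rw [div_lt_iff₀ hd] at hL
    rw [div_lt_iff₀ (by positivity)]
    nlinarith
  set h' := h / (L + 1) with hh'_def
  have hh' : 0 < h' := by positivity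
  have hω' := hω.pos (2 * h') (by positivity)
  have hlim : Filter.Tendsto (fun R : ℕ => ∫ y in 0..(h' * (1 / ((R : ℝ) + 1))), ω y)
      Filter.atTop (nhds 0) := by
    have h1 := (continuousOn_integral_Icc ht hint) 0 ⟨le_rfl, ht⟩
    have h2 : Filter.Tendsto (fun R : ℕ => h' * (1 / ((R : ℝ) + 1))) Filter.atTop
        (nhdsWithin 0 (Icc 0 t)) := by
      refine tendsto_nhdsWithin_iff.2 ⟨?_, Filter.Eventually.of_forall fun R => ⟨by positivity, ?_⟩⟩
      · simpa using tendsto_one_div_add_atTop_nhds_zero_nat.const_mul h'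
      · have h3 : (1 : ℝ) / (R + 1) ≤ 1 := by
          rw [div_le_one (by positivity)]
          simp
        have h4 : h' ≤ h := div_le_self hh.le (by linarith)
        nlinarith
    have h3 := h1.tendsto.comp h2
    simpa [Function.comp_def] using h3
  have hκ : 0 < ε * (h' * ω (2 * h')) / (δ + 1) := by positivity
  obtain ⟨R, hR⟩ := (hlim.eventually (gt_mem_nhds hκ)).exists
  set η := h' * (1 / ((R : ℝ) + 1)) with hη_def
  have hη : 0 < η := by positivity
  have hRη : ((R : ℝ) + 1) * η = h' := by rw [hη_def]; field_simp
  obtain ⟨N, hN⟩ : ∃ N : ℕ, N + 1 = (L + 1) * (R + 1) := ⟨L * R + L + R, by ring⟩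
  have hNη : h = (N + 1) * η := by
    have : (N : ℝ) + 1 = (L + 1) * (R + 1) := by exact_mod_cast hN
    rw [this, mul_assoc, hRη, hh'_def]
    field_simp
  have hRN : R < N := by
    have : 0 < L := by exact_mod_cast hL0
    nlinarith
  have hηh : η ≤ h' := by
    rw [← hRη]
    nlinarith [Nat.cast_nonneg (α := ℝ) R]
  have hle := hω.mul_le_of_linear_growth ht hint hf hf0 hη hc.le hRN hNη hht hP hδ0 hε.le hfδ
    fun y hy => by
      rw [hRη] at hy
      have hyt : y ∈ Icc 0 t :=
        ⟨hy.1, hy.2.trans ((div_le_self hh.le (by linarith)).trans hht)⟩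
      have := hfd y hyt (by
        rw [Real.dist_eq, sub_zero, abs_of_nonneg hy.1]
        exact hy.2.trans_lt hLd)
      rw [hfz, Real.dist_eq, sub_zero] at this
      exact (le_abs_self _).trans this.le
  rw [hRη] at hle
  have hω2 : ω (2 * h') ≤ ω ((R + 2) * η) := by
    refine hω.anti (mem_Ioi.2 (by positivity)) (mem_Ioi.2 (by positivity)) ?_
    linarith
  have hω3 := hω'.trans_le hω2
  have hQ : δ * ((∫ y in 0..η, ω y) / (h' * ω ((R + 2) * η))) ≤ ε := by
    have h1 : (∫ y in 0..η, ω y) / (h' * ω ((R + 2) * η)) ≤ ε / (δ + 1) := by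
      rw [div_le_div_iff₀ (by positivity) (by positivity)]
      rw [lt_div_iff₀ (by positivity)] at hR
      refine hR.le.trans ?_
      gcongr
    calc _ ≤ δ * (ε / (δ + 1)) := by gcongr
      _ = ε * (δ / (δ + 1)) := by ring
      _ ≤ ε * 1 := by
        gcongr
        rw [div_le_one (by positivity)]
        linarith
      _ = ε := mul_one ε
  have h1 : 2 * Wh * (2 * ε + δ * ((∫ y in 0..η, ω y) / (h' * ω ((R + 2) * η)))) ≤
      2 * Wh * (2 * ε + ε) := by gcongr
  have h2 : 8 * Wh * ε = c * h := by rw [hε_def]; field_simp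
  have h3 : 0 < Wh * ε := by positivity
  linarith

end

section

variable {μ : Measure ℝ}

lemma exp_chebyshev (x z d l l₀ : ℝ) (hz : 0 ≤ z) (hd : 0 ≤ d) :
    0 ≤ Real.exp (-l * (x + z + d)) - Real.exp (-l₀ * d) * Real.exp (-l * (x + z))
      - Real.exp (-l₀ * z) * Real.exp (-l * (x + d))
      + Real.exp (-l₀ * z) * Real.exp (-l₀ * d) * Real.exp (-l * x) := by
  have h : 0 ≤ (Real.exp (-l * z) - Real.exp (-l₀ * z)) *
      (Real.exp (-l * d) - Real.exp (-l₀ * d)) := by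
    rcases le_total l l₀ with hl | hl
    · refine mul_nonneg (sub_nonneg.2 (Real.exp_le_exp.2 ?_)) (sub_nonneg.2 (Real.exp_le_exp.2 ?_))
      <;> nlinarith
    · refine mul_nonneg_of_nonpos_of_nonpos (sub_nonpos.2 (Real.exp_le_exp.2 ?_))
        (sub_nonpos.2 (Real.exp_le_exp.2 ?_)) <;> nlinarith
  have h1 := mul_nonneg h (Real.exp_pos (-l * x)).le
  rw [show -l * (x + z + d) = -l * x + -l * z + -l * d by ring, Real.exp_add, Real.exp_add,
    show -l * (x + z) = -l * x + -l * z by ring, Real.exp_add,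
    show -l * (x + d) = -l * x + -l * d by ring, Real.exp_add]
  linarith

/-- The Laplace transform of a nonzero measure on `[0, ∞)` is a log-convex kernel. -/
lemma logConvexKernel_of_bernstein {ω : ℝ → ℝ} (hμ : μ.restrict (Ici 0) ≠ 0)
    (hμfin : ∀ t : ℝ, 0 < t →
      Integrable (fun l : ℝ => Real.exp (-l * t)) (μ.restrict (Ici 0)))
    (hω : ∀ t : ℝ, 0 < t → ω t = ∫ l in Ici (0 : ℝ), Real.exp (-l * t) ∂μ) :
    LogConvexKernel ω := by
  have : NeZero (μ.restrict (Ici (0 : ℝ))) := ⟨hμ⟩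
  have hpos : ∀ x, 0 < x → 0 < ω x := fun x hx => by
    rw [hω x hx]
    exact integral_exp_pos (hμfin x hx)
  refine ⟨hpos, fun x hx y hy hxy => ?_, ?_, fun x y d hx hxy hd => ?_⟩
  · rw [hω x hx, hω y hy]
    refine integral_mono_ae (hμfin y hy) (hμfin x hx) ?_
    filter_upwards [ae_restrict_mem measurableSet_Ici] with l hl
    have : 0 ≤ l := hl
    exact Real.exp_le_exp.2 (by nlinarith)
  · have h := ProbabilityTheory.continuousOn_mgf (X := fun l : ℝ => -l) (μ := μ.restrict (Ici 0))
    have hsub : Ioi (0 : ℝ) ⊆ interior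
        (ProbabilityTheory.integrableExpSet (fun l : ℝ => -l) (μ.restrict (Ici 0))) := by
      refine interior_maximal (fun x hx => ?_) isOpen_Ioi
      have := hμfin x hx
      simp only [mul_comm] at this
      exact this
    refine (h.mono hsub).congr fun x hx => ?_
    rw [hω x hx, ProbabilityTheory.mgf]
    simp only [mul_comm]
  · rcases hd.eq_or_lt with rfl | hd'
    · simp
    have hy : 0 < y := hx.trans_le hxy
    have hxd := hpos (x + d) (by linarith)
    have hx' := hpos x hx
    set Q := ω (x + d) / ω x with hQ
    have hQ0 : 0 < Q := div_pos hxd hx'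
    set l₀ := -Real.log Q / d with hl₀
    have hexp : Real.exp (-l₀ * d) = Q := by
      rw [hl₀, neg_div, neg_neg, div_mul_cancel₀ _ hd'.ne', Real.exp_log hQ0]
    set p := Real.exp (-l₀ * (y - x))
    have h1 := hμfin (y + d) (by linarith)
    have h2 := (hμfin y hy).const_mul Q
    have h3 := (hμfin (x + d) (by linarith)).const_mul p
    have h4 := (hμfin x hx).const_mul (p * Q)
    have hint : 0 ≤ ∫ l in Ici (0 : ℝ), (Real.exp (-l * (y + d)) - Q * Real.exp (-l * y)
        - p * Real.exp (-l * (x + d)) + p * Q * Real.exp (-l * x)) ∂μ := by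
      refine integral_nonneg fun l => ?_
      have := exp_chebyshev x (y - x) d l l₀ (by linarith) hd
      rwa [hexp, add_sub_cancel] at this
    have h12 : Integrable (fun l => Real.exp (-l * (y + d)) - Q * Real.exp (-l * y))
        (μ.restrict (Ici 0)) := h1.sub h2
    have h123 : Integrable (fun l => Real.exp (-l * (y + d)) - Q * Real.exp (-l * y)
        - p * Real.exp (-l * (x + d))) (μ.restrict (Ici 0)) := h12.sub h3
    rw [integral_add h123 h4, integral_sub h12 h3, integral_sub h1 h2,
      integral_const_mul, integral_const_mul, integral_const_mul, ← hω _ hx, ← hω _ hy,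
      ← hω (y + d) (by linarith), ← hω (x + d) (by linarith)] at hint
    have hQx : Q * ω x = ω (x + d) := div_mul_cancel₀ _ hx'.ne'
    have hle : Q * ω y ≤ ω (y + d) := by
      rw [mul_assoc p, hQx] at hint
      linarith
    have := mul_le_mul_of_nonneg_left hle hx'.le
    rw [← hQx]
    linarith

end

section

variable {ω u v A B : ℝ → ℝ} {t : ℝ}

lemma HasDerivAt.exists_lt_slope {F : ℝ → ℝ} {F' c : ℝ} (hF : HasDerivAt F F' t) (hc : c < F') :
    ∃ ε > 0, ∀ r, r ≠ t → |r - t| < ε → c < (F r - F t) / (r - t) := by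
  have h := (hasDerivAt_iff_tendsto_slope.1 hF).eventually (lt_mem_nhds hc)
  rw [eventually_nhdsWithin_iff, Metric.eventually_nhds_iff] at h
  obtain ⟨ε, hε, h⟩ := h
  refine ⟨ε, hε, fun r hr hrε => ?_⟩
  have := h (by rwa [Real.dist_eq]) hr
  rwa [slope_def_field] at this

lemma IntervalIntegrable.of_pos_of_continuousOn_Ioi (hcont : ContinuousOn ω (Ioi 0)) {δ : ℝ}
    (hδ : 0 < δ) (hint : IntervalIntegrable ω volume 0 δ) {r : ℝ} (hr : 0 < r) :
    IntervalIntegrable ω volume 0 r :=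
  hint.trans (hcont.mono fun _ hx => lt_of_lt_of_le (lt_min hδ hr) hx.1).intervalIntegrable

lemma exists_intervalIntegrable_of_convolution (hv : ContinuousOn v (Ici 0)) {r : ℝ} (hr : 0 < r)
    (hvr : v r ≠ 0) (hint : IntervalIntegrable (fun s => ω (r - s) * v s) volume 0 r) :
    ∃ δ > 0, IntervalIntegrable ω volume 0 δ := by
  have hne := (hv.continuousAt (Ici_mem_nhds hr)).eventually_ne hvr
  obtain ⟨ε, hε, h⟩ := Metric.eventually_nhds_iff.1 hne
  have hδ : 0 < min (ε / 2) r := lt_min (by linarith) hr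
  set δ := min (ε / 2) r with hδ_def
  have hδr : δ ≤ r := min_le_right _ _
  have hδε : δ ≤ ε / 2 := min_le_left _ _
  refine ⟨δ, hδ, ?_⟩
  have hle : r - δ ≤ r := by linarith
  have h0 : 0 ≤ r - δ := by linarith
  have hnz : ∀ s ∈ Icc (r - δ) r, v s ≠ 0 := fun s hs => h (by
    rw [Real.dist_eq, abs_lt]
    constructor <;> linarith [hs.1, hs.2])
  have h1 : IntervalIntegrable (fun s => ω (r - s) * v s) volume (r - δ) r :=
    hint.mono_zero hr.le h0 hle le_rfl
  have h2 : ContinuousOn (fun s => (v s)⁻¹) (uIcc (r - δ) r) := by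
    rw [uIcc_of_le hle]
    exact (hv.mono fun s hs => h0.trans hs.1).inv₀ hnz
  have h3 : IntervalIntegrable (fun s => ω (r - s)) volume (r - δ) r := by
    refine (h1.mul_continuousOn h2).congr fun s hs => ?_
    rw [uIoc_of_le hle] at hs
    exact mul_inv_cancel_right₀ (hnz s ⟨hs.1.le, hs.2⟩) _
  have h4 := h3.comp_sub_left r
  simpa using h4.symm

lemma intervalIntegrable_convolution (hint : ∀ r, 0 < r → IntervalIntegrable ω volume 0 r)
    (hv : ContinuousOn v (Ici 0)) {r : ℝ} (hr : 0 < r) :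
    IntervalIntegrable (fun s => ω (r - s) * v s) volume 0 r := by
  refine IntervalIntegrable.mul_continuousOn ?_ (hv.mono fun s hs => ?_)
  · have := (hint r hr).comp_sub_left r
    simpa using this.symm
  · rw [uIcc_of_le hr.le] at hs
    exact hs.1

lemma integral_indicator_sub_eq_convolution (hint : ∀ r, 0 < r → IntervalIntegrable ω volume 0 r)
    (hv : ContinuousOn v (Ici 0)) {x : ℝ} (hx : 0 ≤ x) (hxt : x < t) :
    ∫ y in 0..t, (Ioi 0).indicator ω (y - x) * v (t - y) =
      ∫ s in 0..(t - x), ω (t - x - s) * v s := by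
  have ht : 0 < t := hx.trans_lt hxt
  have hI : IntervalIntegrable (fun s => (Ioi 0).indicator ω (t - s - x) * v s) volume 0 t := by
    have h1 := (intervalIntegrable_indicator_sub_mul (f := fun y => v (t - y)) ht.le (hint t ht)
      (hv.comp (by fun_prop) fun y hy => sub_nonneg.2 hy.2) hx).comp_sub_left t
    simpa using h1.symm
  have h := intervalIntegral.integral_comp_sub_left (a := 0) (b := t)
    (fun s => (Ioi 0).indicator ω (t - s - x) * v s) t
  simp only [sub_sub_cancel, sub_self, sub_zero] at h
  rw [h, ← intervalIntegral.integral_add_adjacent_intervals (b := t - x)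
    (hI.mono_zero ht.le le_rfl (by linarith) (by linarith))
    (hI.mono_zero ht.le (by linarith) (by linarith) le_rfl)]
  have h1 : ∫ s in (t - x)..t, (Ioi 0).indicator ω (t - s - x) * v s = 0 := by
    refine (intervalIntegral.integral_congr fun s hs => ?_).trans intervalIntegral.integral_zero
    rw [uIcc_of_le (by linarith)] at hs
    have : (Ioi 0).indicator ω (t - s - x) = 0 :=
      indicator_of_notMem (by rw [mem_Ioi]; linarith [hs.1]) _
    simp only [this, zero_mul]
  rw [h1, add_zero]
  refine intervalIntegral.integral_congr_ae ?_
  have hae : ∀ᵐ s : ℝ, s ≠ t - x := by simp [ae_iff]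
  filter_upwards [hae] with s hs hs'
  rw [uIoc_of_le (by linarith)] at hs'
  have : s < t - x := lt_of_le_of_ne hs'.2 hs
  rw [indicator_of_mem (by rw [mem_Ioi]; linarith), sub_right_comm]

/-- The inequality for a kernel that is integrable at the origin. -/
lemma LogConvexKernel.half_deriv_le (hω : LogConvexKernel ω)
    (hint : ∀ r, 0 < r → IntervalIntegrable ω volume 0 r)
    (hu : ContinuousOn u (Ici 0)) (ht : 0 < t)
    (hA : ∀ r : ℝ, 0 < r → A r = ∫ s in (0:ℝ)..r, ω (r - s) * u s)
    (hB : ∀ r : ℝ, 0 < r → B r = ∫ s in (0:ℝ)..r, ω (r - s) * (u s) ^ 2)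
    {A' B' : ℝ} (hA' : HasDerivAt A A' t) (hB' : HasDerivAt B B' t) :
    (1 / 2) * B' ≤ u t * A' := by
  have hg : ContinuousOn (fun s => (u s - u t) ^ 2) (Ici 0) := (hu.sub continuousOn_const).pow 2
  have hD : ∀ r, 0 < r → u t ^ 2 * (∫ s in 0..r, ω s) - 2 * u t * A r + B r =
      ∫ s in 0..r, ω (r - s) * (u s - u t) ^ 2 := fun r hr => by
    have h1 := intervalIntegrable_convolution hint hu hr
    have h2 : IntervalIntegrable (fun s => ω (r - s) * (u s) ^ 2) volume 0 r :=
      intervalIntegrable_convolution hint (hu.pow 2) hr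
    have h0 := intervalIntegrable_convolution hint (v := fun _ => 1) continuousOn_const hr
    have hW : ∫ s in 0..r, ω s = ∫ s in 0..r, ω (r - s) * 1 := by
      simp
    rw [hA r hr, hB r hr, hW, ← intervalIntegral.integral_const_mul,
      ← intervalIntegral.integral_const_mul, ← intervalIntegral.integral_sub (h0.const_mul _)
      (h1.const_mul _), ← intervalIntegral.integral_add ((h0.const_mul _).sub (h1.const_mul _)) h2]
    exact intervalIntegral.integral_congr fun s _ => by ring
  have hD' := (((hasDerivAt_integral_of_continuousOn_Ioi hω.cont ht (hint t ht)).const_mul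
    (u t ^ 2)).sub (hA'.const_mul (2 * u t))).add hB'
  have hnonpos : u t ^ 2 * ω t - 2 * u t * A' + B' ≤ 0 := by
    by_contra! hpos
    obtain ⟨ε, hε, hslope⟩ := hD'.exists_lt_slope (half_lt_self hpos)
    have hh : 0 < min (ε / 2) (t / 2) := lt_min (by linarith) (by linarith)
    set h := min (ε / 2) (t / 2) with hh_def
    have hhε : h ≤ ε / 2 := min_le_left _ _
    have hht : h ≤ t / 2 := min_le_right _ _
    refine hω.not_linear_growth (f := fun y => (u (t - y) - u t) ^ 2) ht.le (hint t ht)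
      (hg.comp (by fun_prop) fun y hy => sub_nonneg.2 hy.2) (fun y _ => sq_nonneg _) (by simp)
      (half_pos hpos) hh (by linarith) fun x hx => ?_
    have hxt : x < t := by linarith [hx.2]
    rw [integral_indicator_sub_eq_convolution hint hg le_rfl ht,
      integral_indicator_sub_eq_convolution hint hg hx.1.le hxt, ← hD _ (by linarith),
      ← hD _ (by linarith)]
    have h1 := hslope (t - x) (by linarith [hx.1]) (by
      rw [abs_lt]
      constructor <;> linarith [hx.1, hx.2])
    rw [show t - x - t = -x by ring, div_neg, ← neg_div, lt_div_iff₀ hx.1] at h1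
    simp only [Pi.add_apply, Pi.sub_apply] at h1
    rw [sub_zero]
    linarith
  have h1 := mul_nonneg (sq_nonneg (u t)) (hω.pos t ht).le
  linarith

/-- The inequality for a kernel that is not integrable at the origin, where the convolutions
vanish by convention wherever their integrands are not integrable. -/
lemma LogConvexKernel.half_deriv_le_of_not_integrable (hω : LogConvexKernel ω)
    (hnint : ¬ ∃ δ > 0, IntervalIntegrable ω volume 0 δ)
    (hu : ContinuousOn u (Ici 0)) (ht : 0 < t)
    (hA : ∀ r : ℝ, 0 < r → A r = ∫ s in (0:ℝ)..r, ω (r - s) * u s)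
    (hB : ∀ r : ℝ, 0 < r → B r = ∫ s in (0:ℝ)..r, ω (r - s) * (u s) ^ 2)
    {A' B' : ℝ} (hA' : HasDerivAt A A' t) (hB' : HasDerivAt B B' t) :
    (1 / 2) * B' ≤ u t * A' := by
  have hA0 : ∀ r, 0 < r → u r ≠ 0 → A r = 0 := fun r hr hur => by
    rw [hA r hr]
    exact intervalIntegral.integral_undef fun h =>
      hnint (exists_intervalIntegrable_of_convolution hu hr hur h)
  have hB0 : ∀ r, 0 < r → u r ≠ 0 → B r = 0 := fun r hr hur => by
    rw [hB r hr]
    exact intervalIntegral.integral_undef fun h =>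
      hnint (exists_intervalIntegrable_of_convolution (hu.pow 2) hr (pow_ne_zero 2 hur) h)
  by_cases hut : u t = 0
  · rw [hut, zero_mul]
    suffices B' ≤ 0 by linarith
    by_cases hBt : B t = 0
    · refine (IsLocalMin.hasDerivAt_eq_zero ?_ hB').le
      filter_upwards [lt_mem_nhds ht] with r hr
      rw [hBt, hB r hr]
      have := integral_nonneg_of_ae (μ := volume.restrict (Ioc 0 r))
        (f := fun s => ω (r - s) * (u s) ^ 2) ?_
      · rwa [intervalIntegral.integral_of_le hr.le]
      · have hae : ∀ᵐ s ∂(volume.restrict (Ioc 0 r)), s ≠ r :=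
          ae_restrict_of_ae (by simp [ae_iff])
        filter_upwards [hae, ae_restrict_mem measurableSet_Ioc] with s hs hs'
        exact mul_nonneg (hω.pos _ (sub_pos.2 (lt_of_le_of_ne hs'.2 hs))).le (sq_nonneg _)
    · by_contra! hpos
      obtain ⟨ε, hε, hslope⟩ := hB'.exists_lt_slope hpos
      obtain ⟨ε', hε', hne⟩ := Metric.eventually_nhds_iff.1 (hB'.continuousAt.eventually_ne hBt)
      have hd : 0 < min ε ε' := lt_min hε hε'
      set d := min ε ε' / 2 with hd_def
      have hdε : d < ε := (half_lt_self hd).trans_le (min_le_left _ _)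
      have hdε' : d < ε' := (half_lt_self hd).trans_le (min_le_right _ _)
      have hd0 : 0 < d := half_pos hd
      have hBr : B (t + d) ≠ 0 := hne (by
        rwa [Real.dist_eq, add_sub_cancel_left, abs_of_pos hd0])
      have h1 := hslope (t + d) (by linarith) (by
        rwa [add_sub_cancel_left, abs_of_pos hd0])
      rw [add_sub_cancel_left, div_pos_iff_of_pos_right hd0, sub_pos] at h1
      refine h1.not_ge ?_
      have hI : ∀ r, 0 < r → B r ≠ 0 →
          IntervalIntegrable (fun s => ω (r - s) * (u s) ^ 2) volume 0 r := fun r hr hr' => by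
        rw [hB r hr] at hr'
        by_contra hc
        exact hr' (intervalIntegral.integral_undef hc)
      have hIr := hI (t + d) (by linarith) hBr
      have hIr1 := hIr.mono_zero (y := t) (by linarith) le_rfl ht.le (by linarith)
      have hIr2 := hIr.mono_zero (x := t) (by linarith) ht.le (by linarith) le_rfl
      rw [hB t ht, hB (t + d) (by linarith),
        ← intervalIntegral.integral_add_adjacent_intervals hIr1 hIr2]
      have hz : ∫ s in t..(t + d), ω (t + d - s) * (u s) ^ 2 = 0 := by
        refine (intervalIntegral.integral_congr fun s hs => ?_).trans
          intervalIntegral.integral_zero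
        rw [uIcc_of_le (by linarith)] at hs
        have : u s = 0 := by
          by_contra hus
          refine hne ?_ (hB0 s (ht.trans_le hs.1) hus)
          rw [Real.dist_eq, abs_of_nonneg (by linarith [hs.1])]
          linarith [hs.2]
        simp [this]
      rw [hz, add_zero]
      refine intervalIntegral.integral_mono_on_of_le_Ioo ht.le hIr1 (hI t ht hBt) fun s hs =>
        mul_le_mul_of_nonneg_right ?_ (sq_nonneg _)
      exact hω.anti (mem_Ioi.2 (by linarith [hs.2])) (mem_Ioi.2 (by linarith [hs.2]))
        (by linarith)
  · have hne := (hu.continuousAt (Ici_mem_nhds ht)).eventually_ne hut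
    have hAe : A =ᶠ[nhds t] fun _ => 0 := by
      filter_upwards [hne, lt_mem_nhds ht] with r h1 h2 using hA0 r h2 h1
    have hBe : B =ᶠ[nhds t] fun _ => 0 := by
      filter_upwards [hne, lt_mem_nhds ht] with r h1 h2 using hB0 r h2 h1
    rw [hA'.unique ((hasDerivAt_const t 0).congr_of_eventuallyEq hAe),
      hB'.unique ((hasDerivAt_const t 0).congr_of_eventuallyEq hBe), mul_zero, mul_zero]

end

/-- A derivative vanishes if the function is a convolution with a kernel vanishing on `(0, ∞)`. -/
lemma deriv_convolution_eq_zero {ω v F : ℝ → ℝ} {t F' : ℝ} (hω : ∀ x, 0 < x → ω x = 0)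
    (ht : 0 < t) (hF : ∀ r : ℝ, 0 < r → F r = ∫ s in (0:ℝ)..r, ω (r - s) * v s)
    (hF' : HasDerivAt F F' t) : F' = 0 := by
  have h : F =ᶠ[nhds t] fun _ => 0 := by
    filter_upwards [lt_mem_nhds ht] with r hr
    rw [hF r hr]
    refine (intervalIntegral.integral_congr_ae (g := fun _ => 0) ?_).trans
      intervalIntegral.integral_zero
    have hae : ∀ᵐ s : ℝ, s ≠ r := by simp [ae_iff]
    filter_upwards [hae] with s hs hs'
    rw [uIoc_of_le hr.le] at hs'
    rw [hω _ (sub_pos.2 (lt_of_le_of_ne hs'.2 hs)), zero_mul]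
  exact hF'.unique ((hasDerivAt_const t 0).congr_of_eventuallyEq h)

open MeasureTheory Set

/-- For a completely monotonic kernel `ω` given by a Bernstein representation
`ω t = ∫ λ in [0,∞), exp (-λ t) dμ(λ)` and a continuous bounded `u : [0,∞) → ℝ`,
the convolutions `A t = ∫_0^t ω (t-s) u s ds` and `B t = ∫_0^t ω (t-s) (u s)^2 ds`
satisfy `u t * A' t ≥ (1/2) * B' t` at any `t > 0` where they are differentiable. -/
theorem stmt0 (μ : Measure ℝ)
    (hμfin : ∀ t : ℝ, 0 < t →
      Integrable (fun l : ℝ => Real.exp (-l * t)) (μ.restrict (Ici 0)))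
    (ω : ℝ → ℝ)
    (hω : ∀ t : ℝ, 0 < t → ω t = ∫ l in Ici (0:ℝ), Real.exp (-l * t) ∂μ)
    (u : ℝ → ℝ) (hu : ContinuousOn u (Ici 0))
    (hub : ∃ M : ℝ, ∀ s ∈ Ici (0:ℝ), |u s| ≤ M)
    (t : ℝ) (ht : 0 < t)
    (A B : ℝ → ℝ)
    (hA : ∀ r : ℝ, 0 < r → A r = ∫ s in (0:ℝ)..r, ω (r - s) * u s)
    (hB : ∀ r : ℝ, 0 < r → B r = ∫ s in (0:ℝ)..r, ω (r - s) * (u s) ^ 2)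
    (A' B' : ℝ) (hA' : HasDerivAt A A' t) (hB' : HasDerivAt B B' t) :
    u t * A' ≥ (1 / 2) * B' := by
  change (1 / 2) * B' ≤ u t * A'
  by_cases hμ : μ.restrict (Ici 0) = 0
  · have hω0 : ∀ x, 0 < x → ω x = 0 := fun x hx => by
      rw [hω x hx, hμ, integral_zero_measure]
    rw [deriv_convolution_eq_zero hω0 ht hA hA', deriv_convolution_eq_zero hω0 ht hB hB',
      mul_zero, mul_zero]
  have hK := logConvexKernel_of_bernstein hμ hμfin hω
  by_cases hint : ∃ δ > 0, IntervalIntegrable ω volume 0 δ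
  · obtain ⟨δ, hδ, hint⟩ := hint
    exact hK.half_deriv_le (fun r hr => hint.of_pos_of_continuousOn_Ioi hK.cont hδ hr)
      hu ht hA hB hA' hB'
  · exact hK.half_deriv_le_of_not_integrable hint hu ht hA hB hA' hB'
end

section
/- Let 0 < α ≤ 1 and 0 < β ≤ 1, and let z ∈ ℂ with Im z < 0. Then, with complex powers taken in the principal branch, Im((1 + z^α)^{−β}) > 0. In other words, the map W(z) = (1 + z^α)^{−β} sends the open lower half-plane strictly into the open upper half-plane. -/
/-- Multiplying the argument of a point of the open lower half-plane by `a ∈ (0, 1]`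
keeps its sine negative. -/
theorem Complex.sin_arg_mul_neg {w : ℂ} (hw : w.im < 0) {a : ℝ} (ha0 : 0 < a) (ha1 : a ≤ 1) :
    Real.sin (w.arg * a) < 0 := by
  have harg : w.arg < 0 := Complex.arg_neg_iff.mpr hw
  have hpi : -Real.pi < w.arg := Complex.neg_pi_lt_arg w
  apply Real.sin_neg_of_neg_of_neg_pi_lt <;> nlinarith

/-- For `0 < α ≤ 1`, `0 < β ≤ 1`, the map `W z = (1 + z^α)^(-β)` (principal branch)
sends the open lower half-plane strictly into the open upper half-plane. -/
theorem stmt4 (α β : ℝ) (hα0 : 0 < α) (hα1 : α ≤ 1) (hβ0 : 0 < β) (hβ1 : β ≤ 1)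
    (z : ℂ) (hz : z.im < 0) :
    0 < (((1 : ℂ) + z ^ (α : ℂ)) ^ (-(β : ℂ))).im := by
  have hz0 : z ≠ 0 := by
    rintro rfl
    simp at hz
  have hw : ((1 : ℂ) + z ^ (α : ℂ)).im < 0 := by
    rw [Complex.add_im, Complex.one_im, zero_add, Complex.cpow_ofReal_im]
    exact mul_neg_of_pos_of_neg (Real.rpow_pos_of_pos (norm_pos_iff.mpr hz0) _)
      (Complex.sin_arg_mul_neg hz hα0 hα1)
  have hw0 : (1 : ℂ) + z ^ (α : ℂ) ≠ 0 := by
    intro h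
    simp [h] at hw
  rw [← Complex.ofReal_neg, Complex.cpow_ofReal_im, mul_neg, Real.sin_neg]
  exact mul_pos (Real.rpow_pos_of_pos (norm_pos_iff.mpr hw0) _)
    (neg_pos.mpr (Complex.sin_arg_mul_neg hw hβ0 hβ1))
end

section
/- Let 0 < α ≤ 1, 0 < β ≤ 1, and τ > 0. Let δ be analytic on the open upper half-plane ℂ⁺ with Im δ(ζ) < 0 for every ζ ∈ ℂ⁺ (i.e., −δ is a nonconstant Pick function). Then the function w(ζ) = (1 + (δ(ζ)/τ)^α)^{−β}, with complex powers taken in the principal branch, is analytic on ℂ⁺ and satisfies Im w(ζ) > 0 for all ζ ∈ ℂ⁺; that is, w is a Pick function. -/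
open Complex in
/-- For `0 < r ≤ 1`, the principal power `z ↦ z ^ r` maps the lower half-plane to itself. -/
lemma cpow_ofReal_im_neg {z : ℂ} {r : ℝ} (hz : z.im < 0) (hr0 : 0 < r) (hr1 : r ≤ 1) :
    (z ^ (r : ℂ)).im < 0 := by
  have hz0 : z ≠ 0 := by rintro rfl; simp at hz
  have harg : z.arg < 0 := arg_neg_iff.2 hz
  have hpi := neg_pi_lt_arg z
  rw [cpow_ofReal_im]
  refine mul_neg_of_pos_of_neg (Real.rpow_pos_of_pos (norm_pos_iff.2 hz0) r)
    (Real.sin_neg_of_neg_of_neg_pi_lt (mul_neg_of_neg_of_pos harg hr0) ?_)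
  nlinarith

open Complex in
/-- For `0 < r ≤ 1`, the principal power `z ↦ z ^ (-r)` maps the lower half-plane to the upper
half-plane. -/
lemma cpow_neg_ofReal_im_pos {z : ℂ} {r : ℝ} (hz : z.im < 0) (hr0 : 0 < r) (hr1 : r ≤ 1) :
    0 < (z ^ (-(r : ℂ))).im := by
  have h := cpow_ofReal_im_neg hz hr0 hr1
  have h0 : z ^ (r : ℂ) ≠ 0 := fun h0 ↦ by simp [h0] at h
  rw [cpow_neg, inv_im]
  exact div_pos (neg_pos.2 h) (normSq_pos.2 h0)


/-- If `-δ` is a nonconstant Pick function (δ analytic on the open upper half-plane with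
`Im δ < 0` there), then for `0 < α ≤ 1`, `0 < β ≤ 1`, `τ > 0`, the CQ generating function
`w ζ = (1 + (δ ζ / τ)^α)^(-β)` (principal branch) is a Pick function:
analytic on the upper half-plane with `Im w > 0` there. -/
theorem stmt5 (α β τ : ℝ) (hα0 : 0 < α) (hα1 : α ≤ 1) (hβ0 : 0 < β) (hβ1 : β ≤ 1)
    (hτ : 0 < τ)
    (δ : ℂ → ℂ)
    (hδa : DifferentiableOn ℂ δ {z : ℂ | 0 < z.im})
    (hδim : ∀ ζ : ℂ, 0 < ζ.im → (δ ζ).im < 0) :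
    DifferentiableOn ℂ
        (fun ζ : ℂ => ((1 : ℂ) + (δ ζ / (τ : ℂ)) ^ (α : ℂ)) ^ (-(β : ℂ)))
        {z : ℂ | 0 < z.im} ∧
    ∀ ζ : ℂ, 0 < ζ.im →
      0 < ((((1 : ℂ) + (δ ζ / (τ : ℂ)) ^ (α : ℂ)) ^ (-(β : ℂ))).im) := by
  have hdiv : ∀ ζ : ℂ, 0 < ζ.im → (δ ζ / (τ : ℂ)).im < 0 := fun ζ hζ ↦ by
    rw [Complex.div_ofReal_im]
    exact div_neg_of_neg_of_pos (hδim ζ hζ) hτ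
  have hbase : ∀ ζ : ℂ, 0 < ζ.im → ((1 : ℂ) + (δ ζ / (τ : ℂ)) ^ (α : ℂ)).im < 0 :=
    fun ζ hζ ↦ by simpa using cpow_ofReal_im_neg (hdiv ζ hζ) hα0 hα1
  refine ⟨?_, fun ζ hζ ↦ cpow_neg_ofReal_im_pos (hbase ζ hζ) hβ0 hβ1⟩
  have hpow : DifferentiableOn ℂ (fun ζ : ℂ => (δ ζ / (τ : ℂ)) ^ (α : ℂ)) {z : ℂ | 0 < z.im} :=
    (hδa.div_const _).cpow (differentiableOn_const _) fun ζ hζ ↦ Or.inr (hdiv ζ hζ).ne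
  exact (hpow.const_add 1).cpow (differentiableOn_const _) fun ζ hζ ↦ Or.inr (hbase ζ hζ).ne
end

section
/- Let 0 < α < 1 and let γ_0, γ_1 ∈ ℝ with γ_1 ≥ 0 and −(γ_0 + γ_1) > 0. Define for small τ > 0 the function F(τ) = τ^{−1} (1 − e^{−τ}) (−γ_1 e^{−τ} − γ_0)^{(1−α)/α}, using the real power (the base is positive for τ small enough). Then there exist C > 0 and ε > 0 with |F(τ) − 1| ≤ C τ² for all τ ∈ (0, ε) if and only if γ_0 = −(2−α)/(2−2α) and γ_1 = α/(2−2α). -/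
open Asymptotics Filter Topology in
theorem AnalyticAt.sub_affine_isBigO_sq {f : ℝ → ℝ} {f' : ℝ} (hf : AnalyticAt ℝ f 0)
    (hd : HasDerivAt f f' 0) :
    (fun x ↦ f x - (f 0 + x * f')) =O[𝓝 0] fun x ↦ x ^ 2 := by
  obtain ⟨p, hp⟩ := hf
  have h := hp.isBigO_sub_partialSum_pow 2
  have h0 : p.coeff 0 = f 0 := hp.coeff_zero _
  have h1 : p.coeff 1 = f' := by rw [← hd.deriv, hp.deriv]; rfl
  simpa [FormalMultilinearSeries.partialSum, Finset.sum_range_succ, h0, h1,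
    ← norm_pow] using h

open Asymptotics Filter Topology in
theorem Real.one_sub_exp_neg_isBigO :
    (fun x : ℝ ↦ 1 - Real.exp (-x) - (x - x ^ 2 / 2)) =O[𝓝 0] fun x ↦ x ^ 3 := by
  have h := (Real.exp_sub_sum_range_isBigO_pow 3).comp_tendsto
    (continuous_neg.tendsto' (0 : ℝ) 0 neg_zero)
  refine (h.neg_left.neg_right).congr (fun x ↦ ?_) (fun x ↦ ?_)
  · simp [Finset.sum_range_succ, Nat.factorial]
    ring
  · simp only [Function.comp]
    ring

open Asymptotics Filter Topology in
theorem affine_isBigO_sq_nhdsGT_iff {a b : ℝ} :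
    (fun x : ℝ ↦ a + b * x) =O[𝓝[>] 0] (fun x ↦ x ^ 2) ↔ a = 0 ∧ b = 0 := by
  refine ⟨fun h ↦ ?_, ?_⟩
  · have hlim (c : ℕ) (hc : c ≠ 0) : Tendsto (fun x : ℝ ↦ x ^ c) (𝓝[>] 0) (𝓝 0) :=
      ((continuous_pow c).tendsto' 0 0 (zero_pow hc)).mono_left nhdsWithin_le_nhds
    have ha : a = 0 := by
      refine tendsto_nhds_unique ?_ (h.trans_tendsto (hlim 2 two_ne_zero))
      exact (Continuous.tendsto' (by fun_prop) 0 a (by simp)).mono_left nhdsWithin_le_nhds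
    simp only [ha, zero_add] at h
    refine ⟨ha, ?_⟩
    have hb : (fun _ : ℝ ↦ b) =O[𝓝[>] 0] fun x ↦ x := by
      refine (h.mul (isBigO_refl (fun x : ℝ ↦ x⁻¹) _)).congr' ?_ ?_ <;>
      · filter_upwards [self_mem_nhdsWithin] with x (hx : 0 < x)
        field_simp
    exact tendsto_nhds_unique tendsto_const_nhds
      (hb.trans_tendsto (by simpa using hlim 1 one_ne_zero))
  · rintro ⟨rfl, rfl⟩
    simpa using isBigO_zero _ _

open Asymptotics Filter Topology in
theorem isBigO_sq_nhdsGT_zero_iff {f : ℝ → ℝ} :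
    f =O[𝓝[>] 0] (fun x ↦ x ^ 2) ↔
      ∃ C > (0 : ℝ), ∃ ε > (0 : ℝ), ∀ x : ℝ, 0 < x → x < ε → |f x| ≤ C * x ^ 2 := by
  rw [isBigO_iff']
  refine exists_congr fun C ↦ and_congr_right fun _ ↦ ?_
  rw [Filter.Eventually, mem_nhdsGT_iff_exists_Ioo_subset]
  simp [Set.subset_def]

open Asymptotics Filter Topology in
theorem convolution_symbol_isBigO {γ0 γ1 p : ℝ} (hsum : 0 < -(γ0 + γ1)) :
    (fun τ : ℝ ↦ τ⁻¹ * (1 - Real.exp (-τ)) * (-γ1 * Real.exp (-τ) - γ0) ^ p -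
      ((-(γ0 + γ1)) ^ p +
        (γ1 * p * (-(γ0 + γ1)) ^ (p - 1) - (-(γ0 + γ1)) ^ p / 2) * τ))
      =O[𝓝[>] 0] fun τ ↦ τ ^ 2 := by
  set b := -(γ0 + γ1) with hb
  set g : ℝ → ℝ := fun τ ↦ (-γ1 * Real.exp (-τ) - γ0) ^ p with hg
  set B := γ1 * p * b ^ (p - 1) with hB
  have hb0 : -γ1 * Real.exp (-0) - γ0 = b := by simp [hb]; ring
  have hg0 : g 0 = b ^ p := by simp only [hg, hb0]
  have han : AnalyticAt ℝ g 0 := by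
    refine ContDiffAt.analyticAt ?_
    exact ContDiffAt.rpow_const_of_ne (by fun_prop) (by rw [hb0]; exact hsum.ne')
  have hder : HasDerivAt g B 0 := by
    have h : HasDerivAt (fun τ : ℝ ↦ -γ1 * Real.exp (-τ) - γ0) γ1 0 := by
      simpa using (((hasDerivAt_neg (0 : ℝ)).exp).const_mul (-γ1)).sub_const γ0
    have h' := h.rpow_const (p := p) (Or.inl (by rw [hb0]; exact hsum.ne'))
    rwa [hb0] at h'
  have hgO := han.sub_affine_isBigO_sq hder
  have hg1 : g =O[𝓝 0] fun _ ↦ (1 : ℝ) := han.continuousAt.tendsto.isBigO_one ℝ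
  have hlin : (fun τ : ℝ ↦ τ - τ ^ 2 / 2) =O[𝓝 0] fun τ ↦ τ := by
    have h : (fun τ : ℝ ↦ 1 - τ / 2) =O[𝓝 0] fun _ ↦ (1 : ℝ) :=
      (Continuous.tendsto (by fun_prop) 0).isBigO_one ℝ
    exact ((isBigO_refl (fun τ : ℝ ↦ τ) _).mul h).congr (fun τ ↦ by ring) (fun τ ↦ by ring)
  have hcube : (fun τ : ℝ ↦ (1 - Real.exp (-τ)) * g τ - (b ^ p * τ + (B - b ^ p / 2) * τ ^ 2))
      =O[𝓝 0] fun τ ↦ τ ^ 3 := by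
    have h1 := (Real.one_sub_exp_neg_isBigO.mul hg1).congr_right
      (g₂ := fun τ ↦ τ ^ 3) (fun τ ↦ by ring)
    have h2 := (hlin.mul hgO).congr_right (g₂ := fun τ ↦ τ ^ 3) (fun τ ↦ by ring)
    have h3 := (isBigO_refl (fun τ : ℝ ↦ τ ^ 3) (𝓝 0)).const_mul_left (-B / 2)
    refine ((h1.add h2).add h3).congr_left fun τ ↦ ?_
    rw [hg0]
    ring
  refine ((isBigO_refl (fun τ : ℝ ↦ τ⁻¹) _).mul
    (hcube.mono nhdsWithin_le_nhds)).congr' ?_ ?_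
  · filter_upwards [self_mem_nhdsWithin] with τ (hτ : 0 < τ)
    change τ⁻¹ * ((1 - Real.exp (-τ)) * g τ - _) = τ⁻¹ * (1 - Real.exp (-τ)) * g τ - _
    field_simp
  · filter_upwards [self_mem_nhdsWithin] with τ (hτ : 0 < τ)
    field_simp

/-- For `0 < α < 1`, `γ₁ ≥ 0`, `-(γ₀ + γ₁) > 0`, the function
`F τ = τ⁻¹ (1 - e^{-τ}) (-γ₁ e^{-τ} - γ₀)^((1-α)/α)` (real power) satisfies
`F τ = 1 + O(τ²)` as `τ → 0⁺` if and only if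
`γ₀ = -(2-α)/(2-2α)` and `γ₁ = α/(2-2α)`. -/
theorem stmt11 (α : ℝ) (hα0 : 0 < α) (hα1 : α < 1)
    (γ0 γ1 : ℝ) (hγ1 : 0 ≤ γ1) (hsum : 0 < -(γ0 + γ1))
    (F : ℝ → ℝ)
    (hF : ∀ τ : ℝ, 0 < τ →
      F τ = τ⁻¹ * (1 - Real.exp (-τ)) *
        (-γ1 * Real.exp (-τ) - γ0) ^ ((1 - α) / α)) :
    (∃ C > (0:ℝ), ∃ ε > (0:ℝ), ∀ τ : ℝ, 0 < τ → τ < ε →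
        |F τ - 1| ≤ C * τ ^ 2)
      ↔ (γ0 = -(2 - α) / (2 - 2 * α) ∧ γ1 = α / (2 - 2 * α)) := by
  have hp : (1 - α) / α ≠ 0 := (div_pos (sub_pos.2 hα1) hα0).ne'
  have hpow : (-(γ0 + γ1)) ^ ((1 - α) / α) = 1 ↔ -(γ0 + γ1) = 1 := by
    simpa using Real.rpow_left_inj hsum.le zero_le_one hp
  have hα : 1 - α ≠ 0 := (sub_pos.2 hα1).ne'
  have hexp := convolution_symbol_isBigO (p := (1 - α) / α) hsum
  set b := -(γ0 + γ1) with hb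
  set c := γ1 * ((1 - α) / α) * b ^ ((1 - α) / α - 1) - b ^ ((1 - α) / α) / 2 with hc
  have hF' : (fun τ ↦ (F τ - 1) - ((b ^ ((1 - α) / α) - 1) + c * τ))
      =O[nhdsWithin 0 (Set.Ioi 0)] fun τ ↦ τ ^ 2 := by
    refine hexp.congr' ?_ Filter.EventuallyEq.rfl
    filter_upwards [self_mem_nhdsWithin] with τ hτ
    rw [hF τ hτ]
    ring
  rw [← isBigO_sq_nhdsGT_zero_iff (f := fun τ ↦ F τ - 1)]
  have hiff : (fun τ ↦ F τ - 1) =O[nhdsWithin 0 (Set.Ioi 0)] (fun τ ↦ τ ^ 2) ↔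
      (fun τ ↦ (b ^ ((1 - α) / α) - 1) + c * τ)
        =O[nhdsWithin 0 (Set.Ioi 0)] fun τ ↦ τ ^ 2 :=
    ⟨fun h ↦ (h.sub hF').congr_left fun τ ↦ by ring,
      fun h ↦ (hF'.add h).congr_left fun τ ↦ by ring⟩
  rw [hiff, affine_isBigO_sq_nhdsGT_iff, sub_eq_zero, hpow]
  constructor
  · rintro ⟨hb1, hc0⟩
    rw [hc, hb1, Real.one_rpow, Real.one_rpow] at hc0
    have h1 : γ1 = α / (2 - 2 * α) := by
      field_simp at hc0 ⊢
      linarith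
    refine ⟨?_, h1⟩
    have h0 : γ0 = -1 - γ1 := by linarith
    rw [h0, h1]
    field_simp
    ring
  · rintro ⟨h0, h1⟩
    have hb1 : b = 1 := by
      rw [hb, h0, h1]
      field_simp
      ring
    refine ⟨hb1, ?_⟩
    rw [hc, hb1, Real.one_rpow, Real.one_rpow, h1]
    field_simp
    ring
end

section
/- Let 0 < α < 1, 0 < β ≤ 1, and τ > 0. Let G be analytic on the open upper half-plane ℂ⁺ with Im G(ζ) < 0 for every ζ ∈ ℂ⁺ (i.e., −G is a nonconstant Pick function). Then the function w(ζ) = (1 + ((1−ζ)/τ)^α · G(ζ)^{1−α})^{−β}, with all complex powers taken in the principal branch, is analytic on ℂ⁺ and satisfies Im w(ζ) > 0 for all ζ ∈ ℂ⁺; that is, w is a Pick function. -/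
open Complex in
/-- A weighted geometric mean of two points of the open lower half-plane, formed with principal
powers, lies in the open lower half-plane. -/
lemma Complex.cpow_mul_cpow_one_sub_im_neg {α : ℝ} (h0 : 0 < α) (h1 : α < 1) {a b : ℂ}
    (ha : a.im < 0) (hb : b.im < 0) :
    (a ^ (α : ℂ) * b ^ ((1 - α : ℝ) : ℂ)).im < 0 := by
  have ha0 : a ≠ 0 := by rintro rfl; simp at ha
  have hb0 : b ≠ 0 := by rintro rfl; simp at hb
  rw [cpow_def_of_ne_zero ha0, cpow_def_of_ne_zero hb0, ← Complex.exp_add, exp_im]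
  refine mul_neg_of_pos_of_neg (Real.exp_pos _) ?_
  rw [add_im, im_mul_ofReal, im_mul_ofReal, log_im, log_im]
  have ha1 := arg_neg_iff.2 ha
  have hb1 := arg_neg_iff.2 hb
  have ha2 := neg_pi_lt_arg a
  have hb2 := neg_pi_lt_arg b
  apply Real.sin_neg_of_neg_of_neg_pi_lt <;> nlinarith

open Complex in
/-- Principal powers with exponent in `[-1, 0)` map the open lower half-plane into the open upper
half-plane. -/
lemma Complex.cpow_neg_im_pos {β : ℝ} (h0 : 0 < β) (h1 : β ≤ 1) {z : ℂ} (hz : z.im < 0) :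
    0 < (z ^ (-(β : ℂ))).im := by
  have hz0 : z ≠ 0 := by rintro rfl; simp at hz
  rw [cpow_def_of_ne_zero hz0, exp_im, ← ofReal_neg, im_mul_ofReal, log_im]
  refine mul_pos (Real.exp_pos _) ?_
  have hz1 := arg_neg_iff.2 hz
  have hz2 := neg_pi_lt_arg z
  apply Real.sin_pos_of_pos_of_lt_pi <;> nlinarith

/-- If `-G` is a nonconstant Pick function, then for `0 < α < 1`, `0 < β ≤ 1`, `τ > 0`,
the modified generating function `w ζ = (1 + ((1-ζ)/τ)^α G(ζ)^{1-α})^(-β)`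
(principal-branch powers) is a Pick function: analytic on the open upper
half-plane with `Im w > 0` there. -/
theorem stmt12 (α β τ : ℝ) (hα0 : 0 < α) (hα1 : α < 1) (hβ0 : 0 < β) (hβ1 : β ≤ 1)
    (hτ : 0 < τ)
    (G : ℂ → ℂ)
    (hGa : DifferentiableOn ℂ G {z : ℂ | 0 < z.im})
    (hGim : ∀ ζ : ℂ, 0 < ζ.im → (G ζ).im < 0) :
    DifferentiableOn ℂ
        (fun ζ : ℂ =>
          ((1 : ℂ) + (((1 : ℂ) - ζ) / (τ : ℂ)) ^ (α : ℂ) * (G ζ) ^ ((1 - α : ℝ) : ℂ))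
            ^ (-(β : ℂ)))
        {z : ℂ | 0 < z.im} ∧
    ∀ ζ : ℂ, 0 < ζ.im →
      0 < ((((1 : ℂ) + (((1 : ℂ) - ζ) / (τ : ℂ)) ^ (α : ℂ) * (G ζ) ^ ((1 - α : ℝ) : ℂ))
            ^ (-(β : ℂ))).im) := by
  have hA : ∀ ζ : ℂ, 0 < ζ.im → (((1 : ℂ) - ζ) / (τ : ℂ)).im < 0 := fun ζ hζ => by
    rw [Complex.div_ofReal_im]
    exact div_neg_of_neg_of_pos (by simpa using hζ) hτ
  have hB : ∀ ζ : ℂ, 0 < ζ.im →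
      ((1 : ℂ) + (((1 : ℂ) - ζ) / (τ : ℂ)) ^ (α : ℂ) * (G ζ) ^ ((1 - α : ℝ) : ℂ)).im < 0 :=
    fun ζ hζ => by
      rw [Complex.add_im, Complex.one_im, zero_add]
      exact Complex.cpow_mul_cpow_one_sub_im_neg hα0 hα1 (hA ζ hζ) (hGim ζ hζ)
  refine ⟨?_, fun ζ hζ => Complex.cpow_neg_im_pos hβ0 hβ1 (hB ζ hζ)⟩
  have hbase : DifferentiableOn ℂ (fun ζ : ℂ => ((1 : ℂ) - ζ) / (τ : ℂ)) {z : ℂ | 0 < z.im} := by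
    fun_prop
  refine DifferentiableOn.cpow_const (DifferentiableOn.const_add _ (DifferentiableOn.mul
    (hbase.cpow_const fun ζ hζ => ?_) (hGa.cpow_const fun ζ hζ => ?_))) fun ζ hζ => ?_
  · exact Or.inr (hA ζ hζ).ne
  · exact Or.inr (hGim ζ hζ).ne
  · exact Or.inr (hB ζ hζ).ne
end

section
/- Let 0 < α < 1, 0 < β < 1, and τ > 0. Define on the open upper half-plane ℂ⁺ the function w(ζ) = [ 1 + ((1−ζ)/τ)^α · ((2−α)/(2−2α))^{1−α} · (1 − (α/(2−α)) ζ)^{1−α} ]^{−β}, with all complex powers taken in the principal branch. Then w is analytic on ℂ⁺ and Im w(ζ) > 0 for every ζ ∈ ℂ⁺; that is, w is a Pick function. -/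
/-- The interpolated product `a ^ α * b ^ (1 - α)` stays in the lower half-plane when
`a` and `b` do, also after multiplication by a positive real. -/
theorem im_cpow_mul_ofReal_mul_cpow_neg {a b : ℂ} {α C : ℝ} (hα0 : 0 < α) (hα1 : α < 1)
    (ha : a.im < 0) (hb : b.im < 0) (hC : 0 < C) :
    (a ^ (α : ℂ) * (C : ℂ) * b ^ ((1 - α : ℝ) : ℂ)).im < 0 := by
  have ha0 : a ≠ 0 := by rintro rfl; simp at ha
  have hb0 : b ≠ 0 := by rintro rfl; simp at hb
  have key : a ^ (α : ℂ) * (C : ℂ) * b ^ ((1 - α : ℝ) : ℂ)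
      = (C : ℂ) * Complex.exp (Complex.log a * α + Complex.log b * ((1 - α : ℝ) : ℂ)) := by
    rw [Complex.cpow_def_of_ne_zero ha0, Complex.cpow_def_of_ne_zero hb0, Complex.exp_add]
    ring
  have ha1 := Complex.arg_neg_iff.mpr ha
  have hb1 := Complex.arg_neg_iff.mpr hb
  have ha2 := Complex.neg_pi_lt_arg a
  have hb2 := Complex.neg_pi_lt_arg b
  rw [key, Complex.im_ofReal_mul, Complex.exp_im]
  refine mul_neg_of_pos_of_neg hC (mul_neg_of_pos_of_neg (Real.exp_pos _)
    (Real.sin_neg_of_neg_of_neg_pi_lt ?_ ?_))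
  all_goals
    simp only [Complex.add_im, Complex.mul_im, Complex.ofReal_re, Complex.ofReal_im,
      Complex.log_im]
    nlinarith

/-- A negative power with exponent in `(-1, 0)` maps the lower half-plane to the upper one. -/
theorem im_cpow_neg_pos {z : ℂ} {β : ℝ} (hβ0 : 0 < β) (hβ1 : β < 1) (hz : z.im < 0) :
    0 < (z ^ (-(β : ℂ))).im := by
  have hz0 : z ≠ 0 := by rintro rfl; simp at hz
  have h1 := Complex.arg_neg_iff.mpr hz
  have h2 := Complex.neg_pi_lt_arg z
  rw [Complex.cpow_def_of_ne_zero hz0, Complex.exp_im]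
  refine mul_pos (Real.exp_pos _) (Real.sin_pos_of_pos_of_lt_pi ?_ ?_)
  all_goals
    simp only [Complex.mul_im, Complex.neg_im, Complex.neg_re, Complex.ofReal_re,
      Complex.ofReal_im, Complex.log_im]
    nlinarith


/-- The second-order CQ generating function for the Havriliak–Negami kernel,
`w ζ = [1 + ((1-ζ)/τ)^α ((2-α)/(2-2α))^{1-α} (1 - (α/(2-α))ζ)^{1-α}]^{-β}`
(principal-branch complex powers), is a Pick function: analytic on the open
upper half-plane with strictly positive imaginary part there. -/
theorem stmt14 (α β τ : ℝ) (hα0 : 0 < α) (hα1 : α < 1) (hβ0 : 0 < β) (hβ1 : β < 1)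
    (hτ : 0 < τ) :
    DifferentiableOn ℂ
        (fun ζ : ℂ =>
          ((1 : ℂ) + (((1 : ℂ) - ζ) / (τ : ℂ)) ^ (α : ℂ)
              * (((2 - α) / (2 - 2 * α) : ℝ) : ℂ) ^ ((1 - α : ℝ) : ℂ)
              * ((1 : ℂ) - ((α / (2 - α) : ℝ) : ℂ) * ζ) ^ ((1 - α : ℝ) : ℂ))
            ^ (-(β : ℂ)))
        {z : ℂ | 0 < z.im} ∧
    ∀ ζ : ℂ, 0 < ζ.im →
      0 < ((((1 : ℂ) + (((1 : ℂ) - ζ) / (τ : ℂ)) ^ (α : ℂ)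
              * (((2 - α) / (2 - 2 * α) : ℝ) : ℂ) ^ ((1 - α : ℝ) : ℂ)
              * ((1 : ℂ) - ((α / (2 - α) : ℝ) : ℂ) * ζ) ^ ((1 - α : ℝ) : ℂ))
            ^ (-(β : ℂ))).im) := by
  have hA : ∀ ζ : ℂ, 0 < ζ.im → (((1 : ℂ) - ζ) / (τ : ℂ)).im < 0 := by
    intro ζ hζ
    rw [Complex.div_ofReal_im]
    exact div_neg_of_neg_of_pos (by simpa using hζ) hτ
  have hB : ∀ ζ : ℂ, 0 < ζ.im → ((1 : ℂ) - ((α / (2 - α) : ℝ) : ℂ) * ζ).im < 0 := by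
    intro ζ hζ
    have hc : 0 < α / (2 - α) := div_pos hα0 (by linarith)
    rw [Complex.sub_im, Complex.one_im, Complex.im_ofReal_mul]
    linarith [mul_pos hc hζ]
  have hbase : 0 < (2 - α) / (2 - 2 * α) := div_pos (by linarith) (by linarith)
  have hP : ∀ ζ : ℂ, 0 < ζ.im →
      ((1 : ℂ) + (((1 : ℂ) - ζ) / (τ : ℂ)) ^ (α : ℂ)
        * (((2 - α) / (2 - 2 * α) : ℝ) : ℂ) ^ ((1 - α : ℝ) : ℂ)
        * ((1 : ℂ) - ((α / (2 - α) : ℝ) : ℂ) * ζ) ^ ((1 - α : ℝ) : ℂ)).im < 0 := by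
    intro ζ hζ
    rw [Complex.add_im, Complex.one_im, zero_add, ← Complex.ofReal_cpow hbase.le]
    exact im_cpow_mul_ofReal_mul_cpow_neg hα0 hα1 (hA ζ hζ) (hB ζ hζ)
      (Real.rpow_pos_of_pos hbase _)
  refine ⟨fun ζ hζ => DifferentiableAt.differentiableWithinAt ?_,
    fun ζ hζ => im_cpow_neg_pos hβ0 hβ1 (hP ζ hζ)⟩
  refine DifferentiableAt.cpow_const ?_ (Or.inr (hP ζ hζ).ne)
  refine (DifferentiableAt.mul (DifferentiableAt.mul ?_ (differentiableAt_const _)) ?_).const_add _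
  · exact DifferentiableAt.cpow_const (by fun_prop) (Or.inr (hA ζ hζ).ne)
  · exact DifferentiableAt.cpow_const (by fun_prop) (Or.inr (hB ζ hζ).ne)
end
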